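/- arXiv:2109.10588 — 11 statements merged into one kernel-verified Lean document; each statement's English description precedes it below -/
import Mathlib

section
/- Let f : X ⇀ X be a continuous partial self-map on a topological space X, and let E, E', E'' be subsets of X. Then for any (a,b,c) ∈ A_f(E,E') and (a',b',c') ∈ A_f(E',E''), one has the equality of partial maps f_{E''E'}^{(a',b',c')} ∘ f_{E'E}^{(a,b,c)} = f_{E''E}^{(a+a',b+b',c+c')}; in particular their domains coincide: ⋂_{i=0}^{b} f^{-i}(E) ∩ ⋂_{i'=a}^{c} f^{-i'}(E') ∩ f^{-c}(⋂_{j'=0}^{b'} f^{-j'}(E') ∩ ⋂_{j''=a'}^{c'} f^{-j''}(E'')) = ⋂_{i=0}^{b+b'} f^{-i}(E) ∩ ⋂_{i''=a+a'}^{c+c'} f^{-i''}(E''). -/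
open Set Function

namespace ConleyDisc

variable {X : Type*} [TopologicalSpace X]

/-- `f^{-n}(E)`: the preimage of `E` under the `n`-th iterate of the partial map
with underlying function `f` and domain `D`. -/
def pre (f : X → X) (D : Set X) (n : ℕ) (E : Set X) : Set X :=
  {x | (∀ i < n, f^[i] x ∈ D) ∧ f^[n] x ∈ E}

/-- `(a,b,c)` is `(E,E')`-admissible relative to the partial map `(f, D)`. -/
def adm (f : X → X) (D : Set X) (E E' : Set X) (a b c : ℕ) : Prop :=
  a ≤ b ∧ b ≤ c ∧
    (⋂ i ≤ b, pre f D i E) ⊆ pre f D a E' ∧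
    (⋂ i ≤ c - a, pre f D i E') ⊆ pre f D (b - a) E

/-- Properness of the partial map obtained by restricting `g` to `S`, viewed as a map
into the subspace `T`. -/
def PProper {α β : Type*} [TopologicalSpace α] [TopologicalSpace β]
    (g : α → β) (S : Set α) (T : Set β) : Prop :=
  ∀ h : Set.MapsTo g S T, IsProperMap (Set.MapsTo.restrict g S T h)

/-- `S` is open in the subspace `A`. -/
def POpen {α : Type*} [TopologicalSpace α] (S A : Set α) : Prop :=
  IsOpen {x : A | (x : α) ∈ S}

/-- The domain of the partial map `f_{E'E}^{(a,b,c)}`. -/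
def dmain (f : X → X) (D : Set X) (E E' : Set X) (a b c : ℕ) : Set X :=
  (⋂ i ≤ b, pre f D i E) ∩ ⋂ i ∈ Set.Icc a c, pre f D i E'

/-- The `f`-invariant part of `E`. -/
def invPart (f : X → X) (D : Set X) (E : Set X) : Set X :=
  ⋂ (a : ℕ) (b : ℕ) (_ : a ≤ b), f^[a] '' ⋂ i ≤ b, pre f D i E

/-- `S` is `f`-invariant. -/
def Invariant (f : X → X) (D : Set X) (S : Set X) : Prop :=
  S ⊆ D ∧ f '' S = S

/-- `E` is an isolating neighbourhood of `S`. -/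
def Isolating (f : X → X) (D : Set X) (S E : Set X) : Prop :=
  S ⊆ interior E ∧ IsCompact (closure E) ∧ closure E ⊆ D ∧ S = invPart f D (closure E)

/-- The relation `E ∼_f E'`. -/
def Sim (f : X → X) (D : Set X) (E E' : Set X) : Prop :=
  ∃ a b a' b' : ℕ, a ≤ b ∧ a' ≤ b' ∧
    (⋂ i ≤ b, pre f D i E) ⊆ pre f D a E' ∧
    (⋂ i ≤ b', pre f D i E') ⊆ pre f D a' E

/-- `E` is weakly `f`-compactifiable: the induced partial self-map `f_E`
(with domain `E ∩ f^{-1}(E)`) is proper and openly defined. -/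
def WCptif (f : X → X) (D : Set X) (E : Set X) : Prop :=
  PProper f (E ∩ pre f D 1 E) E ∧ POpen (E ∩ pre f D 1 E) E

/-- `E` is `f`-compactifiable. -/
def Cptif (f : X → X) (D : Set X) (E : Set X) : Prop :=
  WCptif f D E ∧ LocallyCompactSpace E ∧ T2Space E


theorem mem_dmain_iff (f : X → X) (D E E' : Set X) (a b c : ℕ) (hab : a ≤ b) (hbc : b ≤ c)
    (x : X) : x ∈ dmain f D E E' a b c ↔
      (∀ k < c, f^[k] x ∈ D) ∧ (∀ i ≤ b, f^[i] x ∈ E) ∧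
        ∀ i, a ≤ i → i ≤ c → f^[i] x ∈ E' := by
  simp only [dmain, pre, mem_inter_iff, mem_iInter, mem_setOf_eq, mem_Icc]
  constructor
  · rintro ⟨h, h'⟩
    exact ⟨(h' c ⟨hab.trans hbc, le_rfl⟩).1, fun i hi => (h i hi).2,
      fun i h1 h2 => (h' i ⟨h1, h2⟩).2⟩
  · rintro ⟨h, h', h''⟩
    exact ⟨fun i hi => ⟨fun k hk => h k (by omega), h' i hi⟩,
      fun i hi => ⟨fun k hk => h k (by omega), h'' i hi.1 hi.2⟩⟩

/-- Inclusion `⋂_{i ≤ m} f^{-i}(E) ⊆ f^{-l}(E')` read along an orbit. -/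
theorem orbit_step (f : X → X) (D E E' : Set X) (m l : ℕ)
    (h : (⋂ i ≤ m, pre f D i E) ⊆ pre f D l E') (x : X) (N : ℕ)
    (hD : ∀ k < N, f^[k] x ∈ D) (n : ℕ) (hn : n + m ≤ N)
    (hE : ∀ i, n ≤ i → i ≤ n + m → f^[i] x ∈ E) : f^[n + l] x ∈ E' := by
  have key : f^[n] x ∈ ⋂ i ≤ m, pre f D i E := by
    simp only [pre, mem_iInter, mem_setOf_eq, ← iterate_add_apply]
    exact fun i hi => ⟨fun k hk => hD _ (by omega), hE _ (by omega) (by omega)⟩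
  have := (h key).2
  rwa [← iterate_add_apply, add_comm] at this

theorem stmt2 (f : X → X) (D : Set X) (hf : ContinuousOn f D) (E E' E'' : Set X)
    (a b c a' b' c' : ℕ) (h1 : adm f D E E' a b c) (h2 : adm f D E' E'' a' b' c') :
    dmain f D E E' a b c ∩ pre f D c (dmain f D E' E'' a' b' c')
        = dmain f D E E'' (a + a') (b + b') (c + c') ∧
      ∀ x ∈ dmain f D E E' a b c ∩ pre f D c (dmain f D E' E'' a' b' c'),
        f^[c'] (f^[c] x) = f^[c + c'] x := by
  obtain ⟨hab, hbc, h1, h1'⟩ := h1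
  obtain ⟨hab', hbc', h2, h2'⟩ := h2
  refine ⟨?_, fun x _ => by rw [add_comm c, iterate_add_apply]⟩
  ext x
  rw [mem_inter_iff, mem_dmain_iff f D E E' a b c hab hbc,
    mem_dmain_iff f D E E'' _ _ _ (by omega) (by omega)]
  change _ ∧ (_ ∧ f^[c] x ∈ dmain f D E' E'' a' b' c') ↔ _
  rw [mem_dmain_iff f D E' E'' a' b' c' hab' hbc']
  simp only [← iterate_add_apply]
  have s1 := orbit_step f D _ _ _ _ h1 x (c + c')
  have s1' := orbit_step f D _ _ _ _ h1' x (c + c')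
  have s2 := orbit_step f D _ _ _ _ h2 x (c + c')
  have s2' := orbit_step f D _ _ _ _ h2' x (c + c')
  constructor
  · rintro ⟨⟨d1, e, e1⟩, -, d2, e2, e3⟩
    have d : ∀ k < c + c', f^[k] x ∈ D := by
      intro k hk
      rcases lt_or_ge k c with h | h
      · exact d1 k h
      · have := d2 (k - c) (by omega)
        rwa [Nat.sub_add_cancel h] at this
    have p : ∀ i, a ≤ i → i ≤ c + b' → f^[i] x ∈ E' := by
      intro i hi hi'
      rcases lt_or_ge i c with h | h
      · exact e1 i hi h.le
      · have := e2 (i - c) (by omega)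
        rwa [Nat.sub_add_cancel h] at this
    refine ⟨d, fun i hi => ?_, fun i hi hi' => ?_⟩
    · rcases le_or_gt i b with h | h
      · exact e i h
      · have := s1' d (i - (b - a)) (by omega) (fun j hj hj' => p j (by omega) (by omega))
        rwa [Nat.sub_add_cancel (by omega)] at this
    · rcases le_or_gt (c + a') i with h | h
      · have := e3 (i - c) (by omega) (by omega)
        rwa [Nat.sub_add_cancel (by omega)] at this
      · have := s2 d (i - a') (by omega) (fun j hj hj' => p j (by omega) (by omega))
        rwa [Nat.sub_add_cancel (by omega)] at this
  · rintro ⟨d, e, e2⟩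
    have p : ∀ i, a ≤ i → i ≤ c + b' → f^[i] x ∈ E' := by
      intro i hi hi'
      rcases le_or_gt i (a + b') with h | h
      · have := s1 d (i - a) (by omega) (fun j hj hj' => e j (by omega))
        rwa [Nat.sub_add_cancel (by omega)] at this
      · have := s2' d (i - (b' - a')) (by omega) (fun j hj hj' => e2 j (by omega) (by omega))
        rwa [Nat.sub_add_cancel (by omega)] at this
    exact ⟨⟨fun k hk => d k (by omega), fun i hi => e i (by omega),
      fun i hi hi' => p i hi (by omega)⟩, fun k hk => d k (by omega),
      fun k hk => d _ (by omega), fun i hi => p _ (by omega) (by omega),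
      fun i hi hi' => e2 _ (by omega) (by omega)⟩

end ConleyDisc
end

section
/- Let X be a locally compact Hausdorff space and f : X ⇀ X a continuous partial self-map. If S is an isolated f-invariant subset of X, then S is compact. -/
open Set Function

namespace ConleyDisc

variable {X : Type*} [TopologicalSpace X]

theorem aux5 {Y : Type*} [TopologicalSpace Y] [T2Space Y]
    (f : Y → Y) (D : Set Y) (hf : ContinuousOn f D) (K : Set Y) (hK : IsCompact K)
    (hKD : K ⊆ D) (b : ℕ) :
    IsCompact (⋂ i ≤ b, pre f D i K) ∧
      ∀ i ≤ b + 1, ContinuousOn f^[i] (⋂ i ≤ b, pre f D i K) := by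
  have step : ∀ b, ContinuousOn f^[b] (⋂ i ≤ b, pre f D i K) →
      ContinuousOn f^[b + 1] (⋂ i ≤ b, pre f D i K) := by
    intro b hb
    rw [Function.iterate_succ']
    refine hf.comp hb ?_
    intro x hx
    simp only [mem_iInter] at hx
    exact hKD (hx b le_rfl).2
  induction b with
  | zero =>
    have h0 : (⋂ i ≤ 0, pre f D i K) = K := by
      ext x
      simp [pre]
    refine ⟨by rw [h0]; exact hK, ?_⟩
    have hc : ContinuousOn f^[0] (⋂ i ≤ 0, pre f D i K) := continuousOn_id
    intro i hi
    rcases Nat.le_succ_iff.1 hi with h | h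
    · obtain rfl : i = 0 := by omega
      exact hc
    · subst h
      exact step 0 hc
  | succ b ih =>
    obtain ⟨ihc, ihf⟩ := ih
    have he : (⋂ i ≤ b + 1, pre f D i K) =
        (⋂ i ≤ b, pre f D i K) ∩ f^[b + 1] ⁻¹' K := by
      ext x
      simp only [mem_iInter, mem_inter_iff, mem_preimage]
      constructor
      · intro h
        exact ⟨fun i hi => h i (by omega), (h (b + 1) le_rfl).2⟩
      · rintro ⟨h, hx⟩ i hi
        refine ⟨fun j hj => hKD (h j (by omega)).2, ?_⟩
        rcases Nat.le_succ_iff.1 hi with h' | h'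
        · exact (h i h').2
        · subst h'
          exact hx
    have hsub : (⋂ i ≤ b + 1, pre f D i K) ⊆ ⋂ i ≤ b, pre f D i K := by
      rw [he]
      exact inter_subset_left
    refine ⟨?_, ?_⟩
    · refine ihc.of_isClosed_subset ?_ hsub
      rw [he]
      exact (ihf (b + 1) le_rfl).preimage_isClosed_of_isClosed ihc.isClosed hK.isClosed
    · intro i hi
      rcases Nat.le_succ_iff.1 hi with h | h
      · exact (ihf i h).mono hsub
      · subst h
        exact step (b + 1) ((ihf (b + 1) le_rfl).mono hsub)

theorem stmt5 {Y : Type*} [TopologicalSpace Y] [LocallyCompactSpace Y] [T2Space Y]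
    (f : Y → Y) (D : Set Y) (hf : ContinuousOn f D) (S : Set Y)
    (hS : Invariant f D S) (hiso : ∃ E : Set Y, Isolating f D S E) :
    IsCompact S := by
  obtain ⟨E, -, hK, hKD, hSE⟩ := hiso
  have hcl : IsClosed S := by
    rw [hSE]
    refine isClosed_iInter fun a => isClosed_iInter fun b => isClosed_iInter fun hab => ?_
    obtain ⟨h1, h2⟩ := aux5 f D hf _ hK hKD b
    exact (h1.image_of_continuousOn (h2 a (by omega))).isClosed
  refine hK.of_isClosed_subset hcl ?_
  intro x hx
  rw [hSE] at hx
  simp only [invPart, mem_iInter] at hx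
  obtain ⟨y, hy, rfl⟩ := hx 0 0 le_rfl
  simp only [mem_iInter] at hy
  exact (hy 0 le_rfl).2

end ConleyDisc
end

section
/- Let X be a locally compact Hausdorff space, f : X ⇀ X a continuous partial self-map, and S an isolated f-invariant subset of X. Then for any two isolating neighbourhoods E and E' of S, one has E ∼_f E'. -/
open Set Function

namespace ConleyDisc

variable {X : Type*} [TopologicalSpace X]

lemma mem_stay {Y : Type*} (f : Y → Y) (D K : Set Y) (hK : K ⊆ D) (b : ℕ) (x : Y) :
    x ∈ (⋂ i ≤ b, pre f D i K) ↔ ∀ i ≤ b, f^[i] x ∈ K := by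
  simp only [mem_iInter, pre, mem_ofPred_eq]
  constructor
  · intro h i hi
    exact (h i hi).2
  · intro h i hi
    exact ⟨fun j hj => hK (h j (by omega)), h i hi⟩

lemma stay_closed {Y : Type*} [TopologicalSpace Y] (f : Y → Y) (K : Set Y)
    (hK : IsClosed K) (hf : ContinuousOn f K) (b : ℕ) :
    IsClosed {x | ∀ i ≤ b, f^[i] x ∈ K} := by
  induction b with
  | zero => simpa using hK
  | succ b ih =>
    have h : {x | ∀ i ≤ b + 1, f^[i] x ∈ K} = K ∩ f ⁻¹' {x | ∀ i ≤ b, f^[i] x ∈ K} := by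
      ext x
      simp only [mem_ofPred_eq, mem_inter_iff, mem_preimage]
      constructor
      · intro h
        exact ⟨h 0 (by omega), fun i hi => h (i + 1) (by omega)⟩
      · rintro ⟨h0, h⟩ i hi
        cases i with
        | zero => exact h0
        | succ i => exact h i (by omega)
    rw [h]
    exact hf.preimage_isClosed_of_isClosed hK ih

lemma iter_cont {Y : Type*} [TopologicalSpace Y] (f : Y → Y) (K : Set Y)
    (hf : ContinuousOn f K) (b a : ℕ) (hab : a ≤ b) :
    ContinuousOn f^[a] {x | ∀ i ≤ b, f^[i] x ∈ K} := by
  induction a with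
  | zero => exact continuousOn_id
  | succ a ih =>
    rw [Function.iterate_succ']
    exact hf.comp (ih (by omega)) fun x hx => hx a (by omega)

lemma half {Y : Type*} [TopologicalSpace Y] [T2Space Y]
    (f : Y → Y) (D : Set Y) (hf : ContinuousOn f D) (S : Set Y) (E E' : Set Y)
    (hE : Isolating f D S E) (hE' : Isolating f D S E') :
    ∃ a b : ℕ, a ≤ b ∧ (⋂ i ≤ b, pre f D i E) ⊆ pre f D a E' := by
  obtain ⟨-, hc, hD, hS⟩ := hE
  have hfK := hf.mono hD
  have hcpt : ∀ n : ℕ, IsCompact (f^[n] '' {x | ∀ i ≤ 2 * n, f^[i] x ∈ closure E}) := by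
    intro n
    refine IsCompact.image_of_continuousOn ?_ (iter_cont f _ hfK _ _ (by omega))
    refine hc.of_isClosed_subset (stay_closed f _ isClosed_closure hfK _) ?_
    intro x hx
    exact hx 0 (by omega)
  have hsub : ∀ a b n : ℕ, a ≤ n → b + n ≤ 2 * n + a →
      f^[n] '' {x | ∀ i ≤ 2 * n, f^[i] x ∈ closure E} ⊆
        f^[a] '' {x | ∀ i ≤ b, f^[i] x ∈ closure E} := by
    rintro a b n han hb _ ⟨x, hx, rfl⟩
    refine ⟨f^[n - a] x, fun i hi => ?_, ?_⟩
    · rw [← Function.iterate_add_apply]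
      exact hx _ (by omega)
    · rw [← Function.iterate_add_apply]
      congr 2
      omega
  have hanti : Antitone fun n : ℕ => f^[n] '' {x | ∀ i ≤ 2 * n, f^[i] x ∈ closure E} :=
    fun m n hmn => hsub m (2 * m) n hmn (by omega)
  have hinter : (⋂ n : ℕ, f^[n] '' {x | ∀ i ≤ 2 * n, f^[i] x ∈ closure E}) ⊆ S := by
    intro y hy
    rw [hS]
    simp only [invPart, mem_iInter]
    intro a b hab
    obtain ⟨x, hx, hxy⟩ := hsub a b b hab (by omega) (mem_iInter.1 hy b)
    exact ⟨x, (mem_stay f D _ hD b x).2 hx, hxy⟩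
  obtain ⟨n, hn⟩ := exists_subset_nhds_of_isCompact
    hanti.directed_ge hcpt (U := interior E')
    (fun x hx => isOpen_interior.mem_nhds (hE'.1 (hinter hx)))
  refine ⟨n, 2 * n, by omega, fun x hx => ?_⟩
  have hx' := (mem_stay f D E (subset_closure.trans hD) _ x).1 hx
  exact ⟨fun i hi => hD (subset_closure (hx' i (by omega))),
    interior_subset (hn ⟨x, fun i hi => subset_closure (hx' i hi), rfl⟩)⟩

theorem stmt6 {Y : Type*} [TopologicalSpace Y] [LocallyCompactSpace Y] [T2Space Y]
    (f : Y → Y) (D : Set Y) (hf : ContinuousOn f D) (S : Set Y)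
    (hS : Invariant f D S) (E E' : Set Y)
    (hE : Isolating f D S E) (hE' : Isolating f D S E') :
    Sim f D E E' := by
  obtain ⟨a, b, hab, h⟩ := half f D hf S E E' hE hE'
  obtain ⟨a', b', hab', h'⟩ := half f D hf S E' E hE' hE
  exact ⟨a, b, a', b', hab, hab', h, h'⟩

end ConleyDisc
end

section
/- Let X be a locally compact Hausdorff space, f : X ⇀ X a continuous partial self-map, and S an isolated f-invariant subset of X. Then the index neighbourhoods of S form a neighbourhood base for S: for every neighbourhood N of S there exists an index neighbourhood E of S with E ⊆ N. -/
open Set Function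

namespace ConleyDisc

variable {X : Type*} [TopologicalSpace X]

/-- Points staying in `K` for times `0..n`. -/
def stay (f : X → X) (K : Set X) (n : ℕ) : Set X := {x | ∀ i ≤ n, f^[i] x ∈ K}

lemma stay_succ (f : X → X) (K : Set X) (n : ℕ) :
    stay f K (n + 1) = K ∩ f ⁻¹' stay f K n := by
  ext x
  constructor
  · intro h
    refine ⟨h 0 (by omega), fun i hi => ?_⟩
    have := h (i + 1) (by omega)
    rwa [iterate_succ_apply] at this
  · rintro ⟨h0, h⟩ i hi
    rcases i with _ | i
    · exact h0
    · rw [iterate_succ_apply]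
      exact h i (by omega)

lemma stay_zero (f : X → X) (K : Set X) : stay f K 0 = K := by
  ext x
  simp [stay]

lemma stay_shift {f : X → X} {K : Set X} {n m : ℕ} {x : X} (j : ℕ) (h : x ∈ stay f K n)
    (hj : m + j ≤ n) : f^[j] x ∈ stay f K m := by
  intro i hi
  rw [← iterate_add_apply]
  exact h _ (by omega)

lemma inter_pre_eq {f : X → X} {D K : Set X} (h : K ⊆ D) (n : ℕ) :
    (⋂ i ≤ n, pre f D i K) = stay f K n := by
  ext x
  simp only [mem_iInter, pre, mem_setOf_eq, stay]
  constructor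
  · intro hx i hi
    exact (hx i hi).2
  · intro hx i hi
    exact ⟨fun j hj => h (hx j (by omega)), hx i hi⟩

lemma mem_invPart {f : X → X} {D K : Set X} (h : K ⊆ D) (x : X) :
    x ∈ invPart f D K ↔ ∀ a b : ℕ, a ≤ b → x ∈ f^[a] '' stay f K b := by
  simp only [invPart, mem_iInter, inter_pre_eq h]

lemma stay_compact [T2Space X] {f : X → X} {K : Set X} (hf : ContinuousOn f K)
    (hK : IsCompact K) (n : ℕ) : IsCompact (stay f K n) := by
  induction n with
  | zero => rwa [stay_zero]
  | succ n ih =>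
    rw [stay_succ]
    exact hK.of_isClosed_subset (hf.preimage_isClosed_of_isClosed hK.isClosed ih.isClosed)
      inter_subset_left

lemma stay_open {f : X → X} {U : Set X} (hf : ContinuousOn f U)
    (hU : IsOpen U) (n : ℕ) : IsOpen (stay f U n) := by
  induction n with
  | zero => rwa [stay_zero]
  | succ n ih =>
    rw [stay_succ]
    exact hf.isOpen_inter_preimage hU ih

lemma iter_cont_s7 {f : X → X} {K : Set X} (hf : ContinuousOn f K) (n : ℕ) :
    ContinuousOn (f^[n]) (stay f K n) := by
  induction n with
  | zero => exact continuousOn_id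
  | succ n ih =>
    rw [stay_succ, iterate_succ]
    exact ih.comp (hf.mono inter_subset_left) (fun x hx => hx.2)

lemma stay_anti (f : X → X) (K : Set X) {m n : ℕ} (h : m ≤ n) :
    stay f K n ⊆ stay f K m := fun _ hx i hi => hx i (hi.trans h)

lemma stay_mono (f : X → X) {K L : Set X} (h : K ⊆ L) (n : ℕ) :
    stay f K n ⊆ stay f L n := fun _ hx i hi => h (hx i hi)

lemma image_stay_sub (f : X → X) (K : Set X) {a b m n : ℕ} (ham : a ≤ m)
    (hbn : b + (m - a) ≤ n) : f^[m] '' stay f K n ⊆ f^[a] '' stay f K b := by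
  rintro _ ⟨y, hy, rfl⟩
  refine ⟨f^[m - a] y, stay_shift _ hy hbn, ?_⟩
  rw [← iterate_add_apply]
  congr 2
  omega

lemma invPart_mono {f : X → X} {D K L : Set X} (h : K ⊆ L) (hL : L ⊆ D) :
    invPart f D K ⊆ invPart f D L := by
  intro x hx
  rw [mem_invPart (h.trans hL)] at hx
  rw [mem_invPart hL]
  intro a b hab
  exact image_mono (stay_mono f h b) (hx a b hab)

lemma inv_iter {f : X → X} {S : Set X} (h : f '' S = S) (n : ℕ) : f^[n] '' S = S := by
  induction n with
  | zero => simp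
  | succ n ih => rw [iterate_succ, image_comp, h, ih]

lemma inv_stay {f : X → X} {S : Set X} (h : f '' S = S) (n : ℕ) : S ⊆ stay f S n := by
  intro x hx i _
  rw [← inv_iter h i]
  exact mem_image_of_mem _ hx

lemma inv_sub_invPart {f : X → X} {D S K : Set X} (h : f '' S = S) (hSK : S ⊆ K)
    (hK : K ⊆ D) : S ⊆ invPart f D K := by
  intro x hx
  rw [mem_invPart hK]
  intro a b _
  rw [← inv_iter h a] at hx
  exact image_mono ((inv_stay h b).trans (stay_mono f hSK b)) hx

lemma image_stay_compact [T2Space X] {f : X → X} {K : Set X} (hf : ContinuousOn f K)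
    (hK : IsCompact K) {a b : ℕ} (h : a ≤ b) : IsCompact (f^[a] '' stay f K b) :=
  (stay_compact hf hK b).image_of_continuousOn ((iter_cont_s7 hf a).mono (stay_anti f K h))

lemma invPart_compact [T2Space X] {f : X → X} {D K : Set X} (hKD : K ⊆ D)
    (hf : ContinuousOn f K) (hK : IsCompact K) : IsCompact (invPart f D K) := by
  refine hK.of_isClosed_subset ?_ ?_
  · unfold invPart
    simp only [inter_pre_eq hKD]
    exact isClosed_iInter fun a => isClosed_iInter fun b => isClosed_iInter fun h =>
      (image_stay_compact hf hK h).isClosed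
  · intro x hx
    have := (mem_invPart hKD x).1 hx 0 0 le_rfl
    simpa [stay_zero] using this

lemma exists_level [T2Space X] {f : X → X} {D K U : Set X} (hKD : K ⊆ D)
    (hf : ContinuousOn f K) (hK : IsCompact K) (hU : IsOpen U) (h : invPart f D K ⊆ U) :
    ∃ n : ℕ, f^[n] '' stay f K (2 * n) ⊆ U := by
  refine exists_subset_nhds_of_isCompact' (V := fun n : ℕ => f^[n] '' stay f K (2 * n))
    ?_ ?_ ?_ ?_
  · refine (antitone_nat_of_succ_le fun n => ?_).directed_ge
    exact image_stay_sub f K (by omega) (by omega)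
  · exact fun n => image_stay_compact hf hK (by omega)
  · exact fun n => (image_stay_compact hf hK (by omega)).isClosed
  · intro x hx
    refine hU.mem_nhds (h ?_)
    rw [mem_invPart hKD]
    intro a b hab
    exact image_stay_sub f K hab (by omega) (mem_iInter.1 hx b)

/-- A set `P ∩ V` with `P` compact, `V` open is compactifiable under suitable conditions. -/
lemma cptif_of [LocallyCompactSpace X] [T2Space X] {f : X → X} {D P V : Set X}
    (hP : IsCompact P) (hV : IsOpen V) (hPD : P ⊆ D) (hf : ContinuousOn f D)
    (h1 : ∀ x ∈ P, f x ∈ V → f x ∈ P) (h2 : ∀ x ∈ P, f x ∈ P ∩ V → x ∈ V) :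
    Cptif f D (P ∩ V) := by
  have hlc : LocallyCompactSpace (P ∩ V : Set X) :=
    (hP.isClosed.isLocallyClosed.inter hV.isLocallyClosed).locallyCompactSpace
  have hfP : ContinuousOn f P := hf.mono hPD
  refine ⟨⟨?_, ?_⟩, hlc, inferInstance⟩
  · intro h
    rw [isProperMap_iff_isCompact_preimage]
    refine ⟨(hfP.mono (fun x hx => hx.1.1)).mapsToRestrict h, ?_⟩
    intro C hC
    rw [Subtype.isCompact_iff]
    have hC' : IsCompact ((↑) '' C : Set X) := hC.image continuous_subtype_val
    have heq : ((↑) '' (MapsTo.restrict f _ _ h ⁻¹' C) : Set X)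
        = P ∩ f ⁻¹' ((↑) '' C : Set X) := by
      ext x
      constructor
      · rintro ⟨y, hy, rfl⟩
        exact ⟨y.2.1.1, _, hy, rfl⟩
      · rintro ⟨hx, c, hc, hcx⟩
        have hfx : f x ∈ P ∩ V := hcx ▸ c.2
        have hxE : x ∈ P ∩ V := ⟨hx, h2 x hx hfx⟩
        have hxd : x ∈ (P ∩ V) ∩ pre f D 1 (P ∩ V) := by
          refine ⟨hxE, ?_, hfx⟩
          intro i hi
          obtain rfl : i = 0 := by omega
          exact hPD hx
        refine ⟨⟨x, hxd⟩, ?_, rfl⟩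
        have : MapsTo.restrict f _ _ h ⟨x, hxd⟩ = c := Subtype.ext hcx.symm
        rw [mem_preimage, this]
        exact hc
    rw [heq]
    exact hP.of_isClosed_subset (hfP.preimage_isClosed_of_isClosed hP.isClosed hC'.isClosed)
      inter_subset_left
  · have heq : {x : (P ∩ V : Set X) | (x : X) ∈ (P ∩ V) ∩ pre f D 1 (P ∩ V)}
        = (fun x : (P ∩ V : Set X) => f x) ⁻¹' V := by
      ext x
      constructor
      · intro hx
        exact hx.2.2.2
      · intro hx
        refine ⟨x.2, ?_, h1 _ x.2.1 hx, hx⟩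
        intro i hi
        obtain rfl : i = 0 := by omega
        exact hPD x.2.1
    unfold POpen
    rw [heq]
    exact hV.preimage (hfP.mono inter_subset_left).restrict

theorem stmt7 {Y : Type*} [TopologicalSpace Y] [LocallyCompactSpace Y] [T2Space Y]
    (f : Y → Y) (D : Set Y) (hf : ContinuousOn f D) (S : Set Y)
    (hS : Invariant f D S) (hiso : ∃ E : Set Y, Isolating f D S E) :
    ∀ N : Set Y, S ⊆ interior N →
      ∃ E : Set Y, E ⊆ N ∧ Isolating f D S E ∧ Cptif f D E := by
  intro N hN
  obtain ⟨E₀, hE1, hE2, hE3, hE4⟩ := hiso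
  have hSc : IsCompact S := by
    rw [hE4]
    exact invPart_compact hE3 (hf.mono hE3) hE2
  obtain ⟨K, hK, hSK, hKsub⟩ := exists_compact_between hSc
    (isOpen_interior.inter isOpen_interior) (subset_inter hE1 hN)
  have hKE : K ⊆ closure E₀ := fun x hx => subset_closure (interior_subset (hKsub hx).1)
  have hKN : K ⊆ N := fun x hx => interior_subset (hKsub hx).2
  have hKD : K ⊆ D := hKE.trans hE3
  have hfK : ContinuousOn f K := hf.mono hKD
  have hKS : invPart f D K ⊆ S := by
    conv_rhs => rw [hE4]
    exact invPart_mono hKE hE3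
  set U := interior K with hU
  have hUo : IsOpen U := isOpen_interior
  have hUK : U ⊆ K := interior_subset
  have hfU : ContinuousOn f U := hfK.mono hUK
  obtain ⟨m, hm⟩ := exists_level hKD hfK hK hUo (hKS.trans hSK)
  have hVo : IsOpen (stay f U m) := stay_open hfU hUo m
  have hSV : S ⊆ stay f U m := (inv_stay hS.2 m).trans (stay_mono f hSK m)
  obtain ⟨W, hW, hSW, hWV⟩ := exists_compact_between hSc hVo hSV
  set P := (f^[m] '' stay f K m) ∪ ⋃ k ∈ Finset.range (m + 1), f^[k] '' W with hPdef
  have hVU : ∀ x ∈ stay f U m, x ∈ U := fun x hx => hx 0 (by omega)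
  have hWK : W ⊆ stay f K m := hWV.trans (stay_mono f hUK m)
  have hPmem : ∀ x, x ∈ P ↔ (∃ y ∈ stay f K m, f^[m] y = x) ∨
      ∃ k ≤ m, ∃ w ∈ W, f^[k] w = x := by
    intro x
    simp [hPdef, Nat.lt_succ_iff]
  have hPc : IsCompact P := by
    refine (image_stay_compact hfK hK le_rfl).union ?_
    refine (Finset.range (m + 1)).isCompact_biUnion fun k hk => ?_
    have hk' : k ≤ m := by
      have := Finset.mem_range.1 hk
      omega
    exact hW.image_of_continuousOn ((iter_cont_s7 hfK k).mono (hWK.trans (stay_anti f K hk')))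
  have hPK : P ⊆ K := by
    intro x hx
    rcases (hPmem x).1 hx with ⟨y, hy, rfl⟩ | ⟨k, hk, w, hw, rfl⟩
    · exact hy m le_rfl
    · exact hWK hw k hk
  have hlast : ∀ y ∈ stay f K m, f (f^[m] y) ∈ K → f (f^[m] y) ∈ P := by
    intro y hy hfy
    refine (hPmem _).2 (Or.inl ⟨f y, ?_, ?_⟩)
    · intro i hi
      rw [← iterate_succ_apply]
      rcases Nat.lt_or_ge i m with h | h
      · exact hy _ h
      · obtain rfl : i = m := le_antisymm hi h
        rw [iterate_succ_apply']
        exact hfy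
    · rw [← iterate_succ_apply, iterate_succ_apply']
  have h1 : ∀ x ∈ P, f x ∈ stay f U m → f x ∈ P := by
    intro x hx hfx
    have hfK' : f x ∈ K := hUK (hVU _ hfx)
    rcases (hPmem x).1 hx with ⟨y, hy, rfl⟩ | ⟨k, hk, w, hw, rfl⟩
    · exact hlast y hy hfK'
    · rcases Nat.lt_or_ge k m with h | h
      · exact (hPmem _).2 (Or.inr ⟨k + 1, h, w, hw, iterate_succ_apply' f k w⟩)
      · obtain rfl : k = m := le_antisymm hk h
        exact hlast w (hWK hw) hfK'
  have h2 : ∀ x ∈ P, f x ∈ P ∩ stay f U m → x ∈ stay f U m := by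
    intro x hx hfx
    have hxU : x ∈ U := by
      rcases (hPmem x).1 hx with ⟨y, hy, rfl⟩ | ⟨k, hk, w, hw, rfl⟩
      · refine hm ⟨y, ?_, rfl⟩
        intro i hi
        rcases Nat.lt_or_ge m i with h | h
        · have := hUK (hfx.2 (i - m - 1) (by omega))
          rw [← iterate_succ_apply' f, ← iterate_add_apply] at this
          rwa [show i - m - 1 + m.succ = i by omega] at this
        · exact hy i h
      · exact hWV hw k hk
    have : x ∈ stay f U (m + 1) := by
      rw [stay_succ]
      exact ⟨hxU, hfx.2⟩
    exact stay_anti f U (Nat.le_succ m) this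
  have hEK : P ∩ stay f U m ⊆ K := inter_subset_left.trans hPK
  have hcK : closure (P ∩ stay f U m) ⊆ K := closure_minimal hEK hK.isClosed
  have hSE : S ⊆ interior (P ∩ stay f U m) := by
    refine (subset_inter hSW hSV).trans (interior_maximal ?_ (isOpen_interior.inter hVo))
    refine inter_subset_inter_left _ (interior_subset.trans fun x hx => ?_)
    exact (hPmem x).2 (Or.inr ⟨0, by omega, x, hx, rfl⟩)
  refine ⟨P ∩ stay f U m, hEK.trans hKN, ⟨hSE, hK.of_isClosed_subset isClosed_closure hcK,
    hcK.trans hKD, ?_⟩, cptif_of hPc hVo (hPK.trans hKD) hf h1 h2⟩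
  refine Subset.antisymm ?_ ((invPart_mono hcK hKD).trans hKS)
  exact inv_sub_invPart hS.2 (hSE.trans (interior_subset.trans subset_closure)) (hcK.trans hKD)

end ConleyDisc
end

section
/- Let f : X ⇀ X be a continuous partial self-map on a topological space X, let E, E' ⊆ X, and let (a,b,c) ∈ A_f(E,E'). Assume the induced partial self-map f_E : E ⇀ E is proper and the induced partial self-map f_{E'} : E' ⇀ E' is openly defined. Put E'' = ⋂_{i=0}^{b} f^{-i}(E) ∩ ⋂_{i'=a}^{c} f^{-i'}(E'). Then: (1) E'' is weakly f-compactifiable (i.e. f_{E''} is proper and openly defined); (2) if moreover E and E' are locally compact Hausdorff in the subspace topology, then E'' is f-compactifiable (i.e. also locally compact Hausdorff). -/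
open Set Function

namespace ConleyDisc

variable {X : Type*} [TopologicalSpace X]

lemma mem_F {f : X → X} {D E : Set X} {b : ℕ} {x : X} :
    x ∈ (⋂ i ≤ b, pre f D i E) ↔ (∀ i < b, f^[i] x ∈ D) ∧ ∀ i ≤ b, f^[i] x ∈ E := by
  simp only [mem_iInter, pre, mem_setOf_eq]
  exact ⟨fun h => ⟨(h b le_rfl).1, fun i hi => (h i hi).2⟩,
    fun h i hi => ⟨fun j hj => h.1 j (by omega), h.2 i hi⟩⟩

lemma mem_dmain {f : X → X} {D E E' : Set X} {a b c : ℕ} (hab : a ≤ b) (hbc : b ≤ c) {x : X} :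
    x ∈ dmain f D E E' a b c ↔ (∀ i < c, f^[i] x ∈ D) ∧ (∀ i ≤ b, f^[i] x ∈ E) ∧
      ∀ i, a ≤ i → i ≤ c → f^[i] x ∈ E' := by
  rw [dmain, mem_inter_iff, mem_F]
  simp only [mem_iInter, pre, mem_setOf_eq, mem_Icc]
  exact ⟨fun h => ⟨(h.2 c ⟨by omega, le_rfl⟩).1, h.1.2, fun i h1 h2 => (h.2 i ⟨h1, h2⟩).2⟩,
    fun h => ⟨⟨fun i hi => h.1 i (by omega), h.2.1⟩,
      fun i hi => ⟨fun j hj => h.1 j (by omega), h.2.2 i hi.1 hi.2⟩⟩⟩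

lemma mem_pre_one {f : X → X} {D E : Set X} {x : X} :
    x ∈ pre f D 1 E ↔ x ∈ D ∧ f x ∈ E := by
  simp [pre]

lemma iter_cont_s8 {f : X → X} {D : Set X} (hf : ContinuousOn f D) (n : ℕ) :
    ContinuousOn f^[n] {x | ∀ i < n, f^[i] x ∈ D} := by
  induction n with
  | zero => exact (continuous_id (X := X)).continuousOn
  | succ n ih =>
    rw [Function.iterate_succ']
    exact hf.comp (ih.mono fun x hx i hi => hx i (by omega)) fun x hx => hx n (by omega)

lemma popen_iff {S A : Set X} (h : S ⊆ A) : POpen S A ↔ ∃ u, IsOpen u ∧ S = u ∩ A := by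
  rw [POpen, isOpen_induced_iff]
  constructor
  · rintro ⟨u, hu, he⟩
    refine ⟨u, hu, ?_⟩
    ext x
    constructor
    · intro hx
      have : (⟨x, h hx⟩ : A) ∈ Subtype.val ⁻¹' u := by rw [he]; exact hx
      exact ⟨this, h hx⟩
    · rintro ⟨hx, hA⟩
      have : (⟨x, hA⟩ : A) ∈ Subtype.val ⁻¹' u := hx
      rw [he] at this; exact this
  · rintro ⟨u, hu, rfl⟩
    refine ⟨u, hu, ?_⟩
    ext x
    simp

lemma open_step {f g : X → X} {D E' V : Set X} (ho : POpen (E' ∩ pre f D 1 E') E')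
    (hg : ContinuousOn g V) (hm : MapsTo g V E') :
    ∃ u, IsOpen u ∧ {x ∈ V | g x ∈ D ∧ f (g x) ∈ E'} = u ∩ V := by
  obtain ⟨o, hoo, he⟩ := (popen_iff inter_subset_left).1 ho
  obtain ⟨u, hu, hue⟩ := continuousOn_iff'.1 hg o hoo
  refine ⟨u, hu, ?_⟩
  rw [← hue]
  ext x
  constructor
  · rintro ⟨hx, h1, h2⟩
    have : g x ∈ E' ∩ pre f D 1 E' := ⟨hm hx, mem_pre_one.2 ⟨h1, h2⟩⟩
    rw [he] at this
    exact ⟨this.1, hx⟩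
  · rintro ⟨h1, hx⟩
    have : g x ∈ o ∩ E' := ⟨h1, hm hx⟩
    rw [← he] at this
    exact ⟨hx, mem_pre_one.1 this.2⟩

lemma proper_res {f : X → X} {D E S T : Set X} (hp : PProper f (E ∩ pre f D 1 E) E)
    (hT : T ⊆ E) (hS : ∀ x, x ∈ S ↔ x ∈ E ∧ x ∈ D ∧ f x ∈ T) (h : MapsTo f S T) :
    IsProperMap (MapsTo.restrict f S T h) := by
  have h0 : MapsTo f (E ∩ pre f D 1 E) E := fun x hx => (mem_pre_one.1 hx.2).2
  have hq := hp h0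
  have hSA : S ⊆ E ∩ pre f D 1 E := fun x hx =>
    ⟨((hS x).1 hx).1, mem_pre_one.2 ⟨((hS x).1 hx).2.1, hT ((hS x).1 hx).2.2⟩⟩
  rw [isProperMap_iff_ultrafilter] at hq ⊢
  refine ⟨?_, ?_⟩
  · rw [continuous_induced_rng]
    have := continuous_subtype_val.comp (hq.1.comp (continuous_inclusion hSA))
    exact this
  · intro 𝒰 y hy
    have := @hq.2 (𝒰.map (inclusion hSA)) (inclusion hT y) (by
      have h2 := ((continuous_inclusion hT).tendsto y).comp hy
      exact h2)
    obtain ⟨x, hx, hxu⟩ := this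
    have hfx : f x.1 = y.1 := congrArg Subtype.val hx
    have hxS : x.1 ∈ S := (hS x.1).2 ⟨x.2.1, (mem_pre_one.1 x.2.2).1, hfx ▸ y.2⟩
    refine ⟨⟨x.1, hxS⟩, Subtype.ext hfx, ?_⟩
    have hi : Topology.IsInducing (inclusion hSA) := (Topology.IsEmbedding.inclusion hSA).isInducing
    rw [hi.nhds_eq_comap, ← Filter.map_le_iff_le_comap]
    exact hxu

lemma lc_of_proper {α β : Type*} [TopologicalSpace α] [TopologicalSpace β] [T2Space α]
    [LocallyCompactSpace β] {g : α → β} (hg : IsProperMap g) : LocallyCompactSpace α := by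
  have : WeaklyLocallyCompactSpace α := ⟨fun x => by
    obtain ⟨K, hK, hx⟩ := exists_compact_mem_nhds (g x)
    exact ⟨g ⁻¹' K, hg.isCompact_preimage hK, hg.continuous.continuousAt hx⟩⟩
  infer_instance

lemma t2_mono {S E : Set X} (h : S ⊆ E) [T2Space E] : T2Space S :=
  (Topology.IsEmbedding.inclusion h).t2Space

lemma F_lc {f : X → X} {D E : Set X} (hp : PProper f (E ∩ pre f D 1 E) E)
    (h1 : LocallyCompactSpace E) (h2 : T2Space E) (b : ℕ) :
    LocallyCompactSpace (⋂ i ≤ b, pre f D i E : Set X) := by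
  have hsub : ∀ n, (⋂ i ≤ n, pre f D i E : Set X) ⊆ E := fun n x hx =>
    (mem_F.1 hx).2 0 (Nat.zero_le _)
  induction b with
  | zero =>
    have : (⋂ i ≤ 0, pre f D i E : Set X) = E := by
      ext x; rw [mem_F]; simp
    rw [this]; exact h1
  | succ n ih =>
    have hS : ∀ x, x ∈ (⋂ i ≤ n + 1, pre f D i E : Set X) ↔
        x ∈ E ∧ x ∈ D ∧ f x ∈ (⋂ i ≤ n, pre f D i E : Set X) := by
      intro x
      rw [mem_F, mem_F]
      simp only [← Function.iterate_succ_apply]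
      constructor
      · rintro ⟨hd, he⟩
        exact ⟨he 0 (by omega), hd 0 (by omega), fun i hi => hd _ (by omega),
          fun i hi => he _ (by omega)⟩
      · rintro ⟨he0, hd0, hd, he⟩
        refine ⟨fun i hi => ?_, fun i hi => ?_⟩
        · cases i with
          | zero => exact hd0
          | succ i => exact hd i (by omega)
        · cases i with
          | zero => exact he0
          | succ i => exact he i (by omega)
    have := t2_mono (hsub (n + 1))
    exact lc_of_proper (proper_res hp (hsub n) hS fun x hx => ((hS x).1 hx).2.2)

lemma open_iter {f : X → X} {D E' F : Set X} {a : ℕ} (hf : ContinuousOn f D)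
    (ho : POpen (E' ∩ pre f D 1 E') E')
    (hF : ∀ x ∈ F, (∀ i < a, f^[i] x ∈ D) ∧ f^[a] x ∈ E') (n : ℕ) :
    ∃ u, IsOpen u ∧ {x ∈ F | (∀ i < a + n, f^[i] x ∈ D) ∧
      ∀ i, a ≤ i → i ≤ a + n → f^[i] x ∈ E'} = u ∩ F := by
  induction n with
  | zero =>
    refine ⟨univ, isOpen_univ, ?_⟩
    ext x
    simp only [mem_setOf_eq, univ_inter, and_iff_left_iff_imp]
    intro hx
    refine ⟨(hF x hx).1, fun i h1 h2 => ?_⟩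
    obtain rfl : i = a := by omega
    exact (hF x hx).2
  | succ n ih =>
    obtain ⟨u, hu, he⟩ := ih
    set V := {x ∈ F | (∀ i < a + n, f^[i] x ∈ D) ∧
      ∀ i, a ≤ i → i ≤ a + n → f^[i] x ∈ E'} with hV
    obtain ⟨v, hv, hve⟩ := open_step (g := f^[a + n]) (V := V) ho
      ((iter_cont_s8 hf (a + n)).mono fun x hx => hx.2.1)
      (fun x hx => hx.2.2 _ (by omega) le_rfl)
    refine ⟨v ∩ u, hv.inter hu, ?_⟩
    rw [inter_assoc, ← he, ← hve]
    ext x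
    simp only [hV, mem_setOf_eq, ← Function.iterate_succ_apply' f]
    constructor
    · rintro ⟨h1, h2, h3⟩
      exact ⟨⟨h1, fun i hi => h2 i (by omega), fun i hi hi' => h3 i hi (by omega)⟩,
        h2 _ (by omega), h3 _ (by omega) (by omega)⟩
    · rintro ⟨⟨h1, h2, h3⟩, h4, h5⟩
      refine ⟨h1, fun i hi => ?_, fun i hi hi' => ?_⟩
      · rcases Nat.lt_or_ge i (a + n) with h | h
        · exact h2 i h
        · obtain rfl : i = a + n := by omega
          exact h4
      · rcases Nat.lt_or_ge i (a + n + 1) with h | h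
        · exact h3 i hi (by omega)
        · obtain rfl : i = a + n + 1 := by omega
          exact h5

theorem stmt8 (f : X → X) (D : Set X) (hf : ContinuousOn f D) (E E' : Set X)
    (a b c : ℕ) (h : adm f D E E' a b c)
    (hp : PProper f (E ∩ pre f D 1 E) E)
    (ho : POpen (E' ∩ pre f D 1 E') E') :
    WCptif f D (dmain f D E E' a b c) ∧
      (LocallyCompactSpace E → T2Space E → LocallyCompactSpace E' → T2Space E' →
        Cptif f D (dmain f D E E' a b c)) := by
  obtain ⟨hab, hbc, hA, hB⟩ := h
  have hmem := fun x => mem_dmain (f := f) (D := D) (E := E) (E' := E') hab hbc (x := x)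
  set Q := dmain f D E E' a b c with hQ
  have hQE : Q ⊆ E := fun x hx => ((hmem x).1 hx).2.1 0 (Nat.zero_le _)
  have hW : WCptif f D Q := by
    refine ⟨fun hm => proper_res hp hQE (fun x => ?_) hm, ?_⟩
    · rw [mem_inter_iff, mem_pre_one]
      refine ⟨fun hx => ⟨hQE hx.1, hx.2⟩, fun ⟨hxE, hxD, hfx⟩ => ⟨?_, hxD, hfx⟩⟩
      have hq := (hmem _).1 hfx
      simp only [← Function.iterate_succ_apply] at hq
      obtain ⟨q1, q2, q3⟩ := hq
      have d1 : ∀ i < c, f^[i] x ∈ D := by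
        intro i hi
        cases i with
        | zero => exact hxD
        | succ i => exact q1 i (by omega)
      have e1 : ∀ i ≤ b, f^[i] x ∈ E := by
        intro i hi
        cases i with
        | zero => exact hxE
        | succ i => exact q2 i (by omega)
      have hxa : f^[a] x ∈ E' := (hA (mem_F.2 ⟨fun i hi => d1 i (by omega), e1⟩)).2
      refine (hmem x).2 ⟨d1, e1, fun i h1 h2 => ?_⟩
      rcases Nat.eq_or_lt_of_le h1 with h | h
      · rw [← h]; exact hxa
      · obtain ⟨j, rfl⟩ : ∃ j, i = j + 1 := ⟨i - 1, by omega⟩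
        exact q3 j (by omega) (by omega)
    · rw [popen_iff inter_subset_left]
      obtain ⟨u, hu, he⟩ := open_step (g := f^[c]) (V := Q) ho
        ((iter_cont_s8 hf c).mono fun x hx => ((hmem x).1 hx).1)
        (fun x hx => ((hmem x).1 hx).2.2 c (by omega) le_rfl)
      refine ⟨u, hu, ?_⟩
      rw [← he]
      ext x
      rw [mem_inter_iff, mem_pre_one, mem_setOf_eq]
      refine and_congr_right fun hx => ?_
      obtain ⟨p1, p2, p3⟩ := (hmem x).1 hx
      rw [hmem, ← Function.iterate_succ_apply' f]
      simp only [← Function.iterate_succ_apply]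
      constructor
      · rintro ⟨hxD, q1, q2, q3⟩
        refine ⟨?_, q3 c (by omega) le_rfl⟩
        cases c with
        | zero => exact hxD
        | succ c => exact q1 c (by omega)
      · rintro ⟨hd, hce⟩
        have d1 : ∀ i ≤ c, f^[i] x ∈ D := fun i hi => by
          rcases Nat.eq_or_lt_of_le hi with h | h
          · rw [h]; exact hd
          · exact p1 i h
        have e1 : ∀ i, a ≤ i → i ≤ c + 1 → f^[i] x ∈ E' := fun i h1 h2 => by
          rcases Nat.eq_or_lt_of_le h2 with h | h
          · rw [h]; exact hce
          · exact p3 i h1 (by omega)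
        have hb : f^[b + 1] x ∈ E := by
          have := (hB (show f^[a + 1] x ∈ _ from mem_F.2 ⟨fun i hi => by
            rw [← Function.iterate_add_apply]; exact d1 _ (by omega), fun i hi => by
            rw [← Function.iterate_add_apply]; exact e1 _ (by omega) (by omega)⟩)).2
          rw [← Function.iterate_add_apply] at this
          rwa [show b - a + (a + 1) = b + 1 by omega] at this
        refine ⟨d1 0 (by omega), fun i hi => d1 _ (by omega), fun i hi => ?_,
          fun i h1 h2 => e1 _ (by omega) (by omega)⟩
        rcases Nat.eq_or_lt_of_le hi with h | h
        · rw [h]; exact hb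
        · exact p2 _ (by omega)
  refine ⟨hW, fun l1 t1 l2 t2 => ⟨hW, ?_, t2_mono hQE⟩⟩
  have hlc := F_lc hp l1 t1 b
  obtain ⟨u, hu, he⟩ := open_iter (F := ⋂ i ≤ b, pre f D i E) (a := a) hf ho
    (fun x hx => hA hx) (c - a)
  have hQF : Q = u ∩ ⋂ i ≤ b, pre f D i E := by
    rw [← he]
    ext x
    rw [hmem, mem_setOf_eq, mem_F, show a + (c - a) = c by omega]
    exact ⟨fun h => ⟨⟨fun i hi => h.1 i (by omega), h.2.1⟩, h.1, h.2.2⟩,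
      fun h => ⟨h.2.1, h.1.2, h.2.2⟩⟩
  have hsub : Q ⊆ ⋂ i ≤ b, pre f D i E := hQF ▸ inter_subset_right
  have hopen : Topology.IsOpenEmbedding (inclusion hsub) := by
    refine ⟨Topology.IsEmbedding.inclusion hsub, ?_⟩
    rw [range_inclusion]
    exact (popen_iff hsub).2 ⟨u, hu, hQF⟩
  exact hopen.locallyCompactSpace

end ConleyDisc
end

section
/- Let F : ℝ≥0 × X ⇀ X be a partial semiflow on a topological space X. (1) F is finite-time proper if and only if F|_{[0,ε]×X} is proper for some ε > 0. (2) F is openly defined if and only if Dom F ∩ ([0,ε] × X) is open in [0,ε] × X for some ε > 0. -/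
open Set Function
open scoped NNReal

/-- A partial semiflow on a topological space `X`: a continuous partial map
`F : ℝ≥0 × X ⇀ X` (underlying total function `toFun`, domain `dom`) such that
`f^0 = id` and `f^t ∘ f^u = f^{t+u}` as partial maps. -/
structure PSemiflow (X : Type*) [TopologicalSpace X] where
  toFun : ℝ≥0 × X → X
  dom : Set (ℝ≥0 × X)
  cont : ContinuousOn toFun dom
  mem_zero : ∀ x : X, (0, x) ∈ dom
  map_zero : ∀ x : X, toFun (0, x) = x
  mem_add : ∀ (t u : ℝ≥0) (x : X),
    (t + u, x) ∈ dom ↔ (u, x) ∈ dom ∧ (t, toFun (u, x)) ∈ dom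
  map_add : ∀ (t u : ℝ≥0) (x : X), (u, x) ∈ dom → (t, toFun (u, x)) ∈ dom →
    toFun (t, toFun (u, x)) = toFun (t + u, x)

/-- Properness of the partial map obtained by restricting `g` to `S`, viewed as a map
into the subspace `T`. -/
def PProper {α β : Type*} [TopologicalSpace α] [TopologicalSpace β]
    (g : α → β) (S : Set α) (T : Set β) : Prop :=
  ∀ h : Set.MapsTo g S T, IsProperMap (Set.MapsTo.restrict g S T h)

namespace PSemiflow

variable {X : Type*} [TopologicalSpace X]

/-- `f^{-t}(E)`: the preimage of `E` under the partial map `f^t`. -/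
def fpre (F : PSemiflow X) (t : ℝ≥0) (E : Set X) : Set X :=
  {x | (t, x) ∈ F.dom ∧ F.toFun (t, x) ∈ E}

/-- `F` is finite-time proper: for every `t ≥ 0`, the restriction `F|_{[0,t] × X}`,
viewed as a partial map, is proper. -/
def FiniteTimeProper (F : PSemiflow X) : Prop :=
  ∀ t : ℝ≥0,
    IsProperMap fun p : ↥(F.dom ∩ (Set.Icc 0 t ×ˢ (Set.univ : Set X))) => F.toFun p.1

/-- `F` is openly defined: its domain is open in `ℝ≥0 × X`. -/
def OpenlyDefined (F : PSemiflow X) : Prop := IsOpen F.dom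

/-- The domain of the induced partial semiflow `F_E`:
`(t, x)` with `x ∈ ⋂_{s ∈ [0,t]} f^{-s}(E)`. -/
def domInd (F : PSemiflow X) (E : Set X) : Set (ℝ≥0 × X) :=
  {p | ∀ s ∈ Set.Icc 0 p.1, p.2 ∈ F.fpre s E}

/-- The induced partial semiflow `F_E : ℝ≥0 × E ⇀ E` is finite-time proper. -/
def IndFiniteTimeProper (F : PSemiflow X) (E : Set X) : Prop :=
  ∀ t : ℝ≥0, PProper F.toFun (F.domInd E ∩ (Set.Icc 0 t ×ˢ (Set.univ : Set X))) E

/-- The induced partial semiflow `F_E : ℝ≥0 × E ⇀ E` is openly defined, i.e. its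
domain is open in `ℝ≥0 × E`. -/
def IndOpenlyDefined (F : PSemiflow X) (E : Set X) : Prop :=
  IsOpen {p : ℝ≥0 × ↥E | (p.1, (p.2 : X)) ∈ F.domInd E}

/-- `(a,b,c)` is `(E,E')`-admissible relative to `F`. -/
def adm (F : PSemiflow X) (E E' : Set X) (a b c : ℝ≥0) : Prop :=
  a ≤ b ∧ b ≤ c ∧
    (⋂ t ∈ Set.Icc (0 : ℝ≥0) b, F.fpre t E) ⊆ F.fpre a E' ∧
    (⋂ t ∈ Set.Icc (0 : ℝ≥0) (c - a), F.fpre t E') ⊆ F.fpre (b - a) E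

/-- The domain of the partial map `f_{E'E}^{(a,b,c)} : E ⇀ E'`. -/
def dmain (F : PSemiflow X) (E E' : Set X) (a b c : ℝ≥0) : Set X :=
  (⋂ t ∈ Set.Icc (0 : ℝ≥0) b, F.fpre t E) ∩ ⋂ t ∈ Set.Icc a c, F.fpre t E'

/-- `S` is `F`-invariant. -/
def Invariant (F : PSemiflow X) (S : Set X) : Prop :=
  ∀ t : ℝ≥0, (∀ x ∈ S, (t, x) ∈ F.dom) ∧ (fun x => F.toFun (t, x)) '' S = S

/-- The `F`-invariant part of `E`. -/
def invPart (F : PSemiflow X) (E : Set X) : Set X :=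
  ⋂ (a : ℝ≥0) (b : ℝ≥0) (_ : a ≤ b),
    (fun x => F.toFun (a, x)) '' ⋂ t ∈ Set.Icc (0 : ℝ≥0) b, F.fpre t E

/-- `E` is an isolating neighbourhood of `S`. -/
def Isolating (F : PSemiflow X) (S E : Set X) : Prop :=
  S ⊆ interior E ∧ IsCompact (closure E) ∧
    (∃ ε : ℝ≥0, 0 < ε ∧ Set.Icc 0 ε ×ˢ closure E ⊆ F.dom) ∧
    S = F.invPart (closure E)

/-- The relation `E ∼_F E'`. -/
def Sim (F : PSemiflow X) (E E' : Set X) : Prop :=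
  ∃ a b a' b' : ℝ≥0, a ≤ b ∧ a' ≤ b' ∧
    (⋂ t ∈ Set.Icc (0 : ℝ≥0) b, F.fpre t E) ⊆ F.fpre a E' ∧
    (⋂ t ∈ Set.Icc (0 : ℝ≥0) b', F.fpre t E') ⊆ F.fpre a' E

/-- `E` is weakly `F`-compactifiable. -/
def WCptif (F : PSemiflow X) (E : Set X) : Prop :=
  F.IndFiniteTimeProper E ∧ F.IndOpenlyDefined E

/-- `E` is `F`-compactifiable. -/
def Cptif (F : PSemiflow X) (E : Set X) : Prop :=
  F.WCptif E ∧ LocallyCompactSpace E ∧ T2Space E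


/-- Ultrafilter form of properness up to time `t`. -/
def UProp (F : PSemiflow X) (t : ℝ≥0) : Prop :=
  ∀ (U : Ultrafilter (ℝ≥0 × X)) (y : X), (∀ᶠ p in (U : Filter (ℝ≥0 × X)), p ∈ F.dom ∧ p.1 ≤ t) →
    Filter.Tendsto F.toFun U (nhds y) →
    ∃ q : ℝ≥0 × X, q ∈ F.dom ∧ q.1 ≤ t ∧ F.toFun q = y ∧ (U : Filter (ℝ≥0 × X)) ≤ nhds q

theorem isProper_iff_uprop (F : PSemiflow X) (t : ℝ≥0) :
    (IsProperMap fun p : ↥(F.dom ∩ (Set.Icc 0 t ×ˢ (Set.univ : Set X))) => F.toFun p.1) ↔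
      F.UProp t := by
  rw [isProperMap_iff_ultrafilter]
  constructor
  · rintro ⟨-, h⟩ U y hU hy
    have hS : F.dom ∩ (Set.Icc 0 t ×ˢ (Set.univ : Set X)) ∈ U := by
      filter_upwards [hU] with p hp
      exact ⟨hp.1, ⟨zero_le, hp.2⟩, trivial⟩
    have hr : Set.range (Subtype.val :
        ↥(F.dom ∩ (Set.Icc 0 t ×ˢ (Set.univ : Set X))) → ℝ≥0 × X) ∈ U := by
      rwa [Subtype.range_coe]
    let V := Ultrafilter.comap U Subtype.val_injective hr
    have hV : Filter.map Subtype.val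
        (V : Filter ↥(F.dom ∩ (Set.Icc 0 t ×ˢ (Set.univ : Set X)))) = (U : Filter (ℝ≥0 × X)) := by
      rw [Ultrafilter.coe_comap, Filter.map_comap_of_mem hr]
    obtain ⟨x, hx, hxV⟩ := @h V y (by
      have : Filter.Tendsto F.toFun (Filter.map Subtype.val
        (V : Filter ↥(F.dom ∩ (Set.Icc 0 t ×ˢ (Set.univ : Set X))))) (nhds y) := by
        rw [hV]; exact hy
      exact Filter.tendsto_map'_iff.1 this)
    refine ⟨x.1, x.2.1, x.2.2.1.2, hx, ?_⟩
    rw [← hV]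
    exact (Filter.map_mono hxV).trans continuous_subtype_val.continuousAt
  · intro h
    refine ⟨?_, ?_⟩
    · exact continuousOn_iff_continuous_domRestrict.1 (F.cont.mono Set.inter_subset_left)
    · intro V y hy
      obtain ⟨q, hq, hqt, hqy, hle⟩ := h (V.map Subtype.val) y (by
        rw [Ultrafilter.coe_map, Filter.eventually_map]
        exact Filter.Eventually.of_forall fun p => ⟨p.2.1, p.2.2.1.2⟩) (by
        rw [Ultrafilter.coe_map]
        exact Filter.tendsto_map'_iff.2 hy)
      have hqS : q ∈ F.dom ∩ (Set.Icc 0 t ×ˢ (Set.univ : Set X)) :=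
        ⟨hq, ⟨zero_le, hqt⟩, trivial⟩
      refine ⟨⟨q, hqS⟩, hqy, ?_⟩
      rw [nhds_subtype_eq_comap, ← Filter.map_le_iff_le_comap]
      exact hle

theorem UProp.mono {F : PSemiflow X} {s t : ℝ≥0} (h : F.UProp t) (hst : s ≤ t) : F.UProp s := by
  intro U y hU hy
  obtain ⟨q, hq, hqt, hqy, hle⟩ := h U y (hU.mono fun p hp => ⟨hp.1, hp.2.trans hst⟩) hy
  refine ⟨q, hq, ?_, hqy, hle⟩
  have h1 : Filter.Tendsto Prod.fst (U : Filter (ℝ≥0 × X)) (nhds q.1) :=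
    (continuous_fst.continuousAt (x := q)).mono_left hle
  exact le_of_tendsto h1 (hU.mono fun p hp => hp.2)

theorem split_mem {F : PSemiflow X} (a s : ℝ≥0) (x : X) :
    (s, x) ∈ F.dom ↔ (min s a, x) ∈ F.dom ∧ (s - a, F.toFun (min s a, x)) ∈ F.dom := by
  rw [← F.mem_add, tsub_add_min]

theorem UProp.add {F : PSemiflow X} {a b : ℝ≥0} (ha : F.UProp a) (hb : F.UProp b) :
    F.UProp (a + b) := by
  intro U y hU hy
  obtain ⟨⟨v, z⟩, hq, hqt, hqy, hle⟩ :=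
    hb (U.map fun p => (p.1 - a, F.toFun (min p.1 a, p.2))) y (by
      rw [Ultrafilter.coe_map, Filter.eventually_map]
      filter_upwards [hU] with p hp
      exact ⟨((split_mem a p.1 p.2).1 hp.1).2, tsub_le_iff_left.2 hp.2⟩) (by
      rw [Ultrafilter.coe_map, Filter.tendsto_map'_iff]
      refine hy.congr' ?_
      filter_upwards [hU] with p hp
      have := (split_mem a p.1 p.2).1 hp.1
      simp only [Function.comp]
      rw [F.map_add _ _ _ this.1 this.2, tsub_add_min])
  rw [Ultrafilter.coe_map, nhds_prod_eq] at hle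
  have hv : Filter.Tendsto (fun p : ℝ≥0 × X => p.1 - a) U (nhds v) :=
    Filter.tendsto_fst.comp hle
  have hz : Filter.Tendsto (fun p : ℝ≥0 × X => F.toFun (min p.1 a, p.2)) U (nhds z) :=
    Filter.tendsto_snd.comp hle
  obtain ⟨⟨u, x⟩, hq', hqt', hqy', hle'⟩ :=
    ha (U.map fun p => (min p.1 a, p.2)) z (by
      rw [Ultrafilter.coe_map, Filter.eventually_map]
      filter_upwards [hU] with p hp
      exact ⟨((split_mem a p.1 p.2).1 hp.1).1, min_le_right _ _⟩) (by
      rw [Ultrafilter.coe_map, Filter.tendsto_map'_iff]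
      exact hz)
  rw [Ultrafilter.coe_map, nhds_prod_eq] at hle'
  have hu : Filter.Tendsto (fun p : ℝ≥0 × X => min p.1 a) U (nhds u) :=
    Filter.tendsto_fst.comp hle'
  have hx : Filter.Tendsto (fun p : ℝ≥0 × X => p.2) U (nhds x) :=
    Filter.Tendsto.comp (g := Prod.snd) (f := fun p : ℝ≥0 × X => (min p.1 a, p.2))
      Filter.tendsto_snd hle'
  subst hqy'
  refine ⟨(v + u, x), (F.mem_add _ _ _).2 ⟨hq', hq⟩, ?_, ?_, ?_⟩
  · rw [add_comm]; exact add_le_add hqt' hqt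
  · rw [← F.map_add _ _ _ hq' hq]; exact hqy
  · rw [nhds_prod_eq]
    have := (hv.add hu).prodMk hx
    simp only [tsub_add_min] at this
    exact this

/-- Every domain point with time at most `t` is interior to the domain. -/
def OProp (F : PSemiflow X) (t : ℝ≥0) : Prop :=
  ∀ s x, s ≤ t → (s, x) ∈ F.dom → F.dom ∈ nhds (s, x)

theorem OProp.add {F : PSemiflow X} {a b : ℝ≥0} (ha : F.OProp a) (hb : F.OProp b) :
    F.OProp (a + b) := by
  intro s x hs hsx
  obtain ⟨h1, h2⟩ := (split_mem a s x).1 hsx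
  have n1 := ha _ _ (min_le_right _ _) h1
  have n2 := hb _ _ (tsub_le_iff_left.2 hs) h2
  have c1 : Filter.Tendsto (fun p : ℝ≥0 × X => (min p.1 a, p.2)) (nhds (s, x))
      (nhds (min s a, x)) :=
    (by fun_prop : Continuous (fun p : ℝ≥0 × X => (min p.1 a, p.2))).tendsto (s, x)
  have c2 : Filter.Tendsto (fun p : ℝ≥0 × X => p.1 - a) (nhds (s, x)) (nhds (s - a)) :=
    (by fun_prop : Continuous (fun p : ℝ≥0 × X => p.1 - a)).tendsto (s, x)
  have c3 : Filter.Tendsto (fun p : ℝ≥0 × X => F.toFun (min p.1 a, p.2)) (nhds (s, x))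
      (nhds (F.toFun (min s a, x))) :=
    Filter.Tendsto.comp (F.cont.continuousAt n1) c1
  have c4 := c2.prodMk_nhds c3
  filter_upwards [c1 n1, c4 n2] with p hp1 hp2
  exact (split_mem a p.1 p.2).2 ⟨hp1, hp2⟩

theorem all_of_add (P : ℝ≥0 → Prop) (hm : ∀ s t, s ≤ t → P t → P s)
    (ha : ∀ a b, P a → P b → P (a + b)) (ε : ℝ≥0) (hε : 0 < ε) (h : P ε) (t : ℝ≥0) : P t := by
  have hn : ∀ n : ℕ, P (n • ε) := by
    intro n
    induction n with
    | zero => exact hm _ _ (by simp) h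
    | succ k ih => rw [succ_nsmul]; exact ha _ _ ih h
  obtain ⟨n, hn'⟩ := Archimedean.arch t hε
  exact hm _ _ hn' (hn n)

theorem stmt10 (F : PSemiflow X) :
    (F.FiniteTimeProper ↔ ∃ ε : ℝ≥0, 0 < ε ∧
      IsProperMap fun p : ↥(F.dom ∩ (Set.Icc 0 ε ×ˢ (Set.univ : Set X))) => F.toFun p.1) ∧
    (F.OpenlyDefined ↔ ∃ ε : ℝ≥0, 0 < ε ∧
      IsOpen {p : ↥(Set.Icc (0 : ℝ≥0) ε ×ˢ (Set.univ : Set X)) | (p : ℝ≥0 × X) ∈ F.dom}) := by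
  constructor
  · constructor
    · exact fun h => ⟨1, one_pos, h 1⟩
    · rintro ⟨ε, hε, h⟩ t
      rw [isProper_iff_uprop] at h ⊢
      exact all_of_add F.UProp (fun s t hst h => h.mono hst) (fun a b ha hb => ha.add hb) ε hε h t
  · constructor
    · intro h
      exact ⟨1, one_pos, IsOpen.preimage continuous_subtype_val h⟩
    · rintro ⟨ε, hε, h⟩
      have h0 : F.OProp (ε / 2) := by
        intro s x hs hsx
        have hsε : s < ε := hs.trans_lt (NNReal.half_lt_self hε.ne')
        obtain ⟨O, hO, hO'⟩ := isOpen_induced_iff.1 h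
        have hmem : ∀ p : ℝ≥0 × X, p.1 ≤ ε → (p ∈ O ↔ p ∈ F.dom) := by
          intro p hp
          exact Set.ext_iff.1 hO' ⟨p, ⟨zero_le, hp⟩, trivial⟩
        have e1 : O ∈ nhds (s, x) := hO.mem_nhds ((hmem _ hsε.le).2 hsx)
        have e2 : ∀ᶠ p : ℝ≥0 × X in nhds (s, x), p.1 < ε :=
          (continuous_fst.tendsto (s, x)).eventually (gt_mem_nhds hsε)
        filter_upwards [e1, e2] with p hp1 hp2
        exact (hmem p hp2.le).1 hp1
      have hall := all_of_add F.OProp (fun s t hst h r x hr => h r x (hr.trans hst))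
        (fun a b ha hb => ha.add hb) (ε / 2) (half_pos hε) h0
      exact isOpen_iff_mem_nhds.2 fun p hp => hall p.1 p.1 p.2 le_rfl hp

end PSemiflow
end

section
/- Let X be a compactly generated weak Hausdorff space and F : ℝ≥0 × X ⇀ X a partial semiflow. (1) If K ⊆ X is compact and [0,ε] × K ⊆ Dom F for some ε > 0, then the induced partial semiflow F_K : ℝ≥0 × K ⇀ K is finite-time proper. (2) If U ⊆ X is open and [0,ε] × U ⊆ Dom F for some ε > 0, then the induced partial semiflow F_U : ℝ≥0 × U ⇀ U is openly defined. -/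
open Set Function
open scoped NNReal

namespace PSemiflow

variable {X : Type*} [TopologicalSpace X]

universe u

/-- `X` is weak Hausdorff: images of compact Hausdorff spaces under continuous maps
are closed. -/
def WeakHausdorffSpace (X : Type u) [TopologicalSpace X] : Prop :=
  ∀ (K : Type u) [TopologicalSpace K] [CompactSpace K] [T2Space K],
    ∀ g : K → X, Continuous g → IsClosed (Set.range g)

/-- `X` is compactly generated: every compactly closed subset is closed. -/
def CompactlyGeneratedSpaceP (X : Type u) [TopologicalSpace X] : Prop :=
  ∀ A : Set X,
    (∀ (K : Type u) [TopologicalSpace K] [CompactSpace K] [T2Space K],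
      ∀ g : K → X, Continuous g → IsClosed (g ⁻¹' A)) → IsClosed A

/-- In a compactly generated weak Hausdorff space, compact subsets are closed. -/
theorem isClosed_of_isCompact_cgwh {Y : Type u} [TopologicalSpace Y]
    (hcg : CompactlyGeneratedSpaceP Y) (hwh : WeakHausdorffSpace Y)
    {A : Set Y} (hA : IsCompact A) : IsClosed A := by
  have hpt : ∀ y : Y, IsClosed ({y} : Set Y) := by
    intro y
    have := hwh PUnit (fun _ => y) continuous_const
    simpa using this
  apply hcg
  intro K _ _ _ g hg
  have hgc : ∀ C : Set K, IsClosed C → IsClosed (g '' C) := by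
    intro C hC
    haveI : CompactSpace C := isCompact_iff_compactSpace.1 hC.isCompact
    have := hwh C (fun c => g c) (hg.comp continuous_subtype_val)
    rwa [show (fun c : C => g c) = g ∘ Subtype.val from rfl, Set.range_comp,
      Subtype.range_coe] at this
  rw [← isOpen_compl_iff, isOpen_iff_mem_nhds]
  intro k hk
  have hk' : g k ∉ A := hk
  have key : Disjoint (nhdsSet A) (nhds (g k) ⊓ Filter.principal (range g)) := by
    rw [hA.disjoint_nhdsSet_left]
    intro a ha
    have hne : a ≠ g k := fun h => hk' (h ▸ ha)
    have hd : Disjoint (g ⁻¹' {a}) (g ⁻¹' {g k}) := by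
      rw [Set.disjoint_left]
      intro z hz hz'
      exact hne (hz.symm.trans hz')
    obtain ⟨U, V, hU, hV, hUa, hVk, hUV⟩ := normal_separation
      ((hpt a).preimage hg) ((hpt (g k)).preimage hg) hd
    have n1 : (g '' Uᶜ)ᶜ ∈ nhds a := by
      apply (hgc _ hU.isClosed_compl).isOpen_compl.mem_nhds
      rintro ⟨z, hz, hza⟩
      exact hz (hUa hza)
    have n2 : (g '' Vᶜ)ᶜ ∈ nhds (g k) := by
      apply (hgc _ hV.isClosed_compl).isOpen_compl.mem_nhds
      rintro ⟨z, hz, hza⟩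
      exact hz (hVk hza)
    rw [Filter.disjoint_iff]
    refine ⟨_, n1, _, Filter.inter_mem_inf n2 (Filter.mem_principal_self _), ?_⟩
    rw [Set.disjoint_left]
    rintro _ h1 ⟨h2, z, rfl⟩
    have hzU : z ∈ U := by
      by_contra h
      exact h1 ⟨z, h, rfl⟩
    have hzV : z ∈ V := by
      by_contra h
      exact h2 ⟨z, h, rfl⟩
    exact Set.disjoint_left.1 hUV hzU hzV
  rw [Filter.disjoint_iff] at key
  obtain ⟨S, hS, T, hT, hST⟩ := key
  rw [Filter.mem_inf_principal] at hT
  filter_upwards [hg.continuousAt hT] with z hz hzA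
  exact Set.disjoint_left.1 hST (subset_of_mem_nhdsSet hS hzA) (hz ⟨z, rfl⟩)

/-- Continuity of the truncated flow. -/
theorem contOn_trunc {Y : Type u} [TopologicalSpace Y] (F : PSemiflow Y) {E : Set Y} {ε : ℝ≥0}
    (hE : Set.Icc 0 ε ×ˢ E ⊆ F.dom) {Z : Type*} [TopologicalSpace Z] {S : Set Z}
    {a : Z → ℝ≥0} {b : Z → Y} (ha : Continuous a) (hb : Continuous b)
    (hbE : ∀ z ∈ S, b z ∈ E) :
    ContinuousOn (fun z => F.toFun (min ε (a z), b z)) S := by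
  apply F.cont.comp (t := F.dom) (by fun_prop)
  intro z hz
  exact hE ⟨⟨zero_le, min_le_left _ _⟩, hbE z hz⟩

theorem domInd_fst {Y : Type u} [TopologicalSpace Y] (F : PSemiflow Y) {E : Set Y}
    {p : ℝ≥0 × Y} (hp : p ∈ F.domInd E) : p.2 ∈ E := by
  have := (hp 0 ⟨le_rfl, zero_le⟩).2
  rwa [F.map_zero] at this

/-- The shift maps the induced domain to itself. -/
theorem domInd_shift {Y : Type u} [TopologicalSpace Y] (F : PSemiflow Y) {E : Set Y} {ε : ℝ≥0}
    {p : ℝ≥0 × Y} (hp : p ∈ F.domInd E) :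
    (p.1 - ε, F.toFun (min ε p.1, p.2)) ∈ F.domInd E := by
  intro r hr
  have hr2 : r ≤ p.1 - ε := hr.2
  have hle : r + min ε p.1 ≤ p.1 := by
    rcases le_total ε p.1 with h | h
    · rw [min_eq_left h]
      exact (add_le_add_left hr2 ε).trans (tsub_add_cancel_of_le h).le
    · rw [tsub_eq_zero_of_le h] at hr2
      rw [min_eq_right h, nonpos_iff_eq_zero.1 hr2, zero_add]
  have h1 := hp (r + min ε p.1) ⟨zero_le, hle⟩
  have h2 := (F.mem_add _ _ _).1 h1.1
  refine ⟨h2.2, ?_⟩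
  show F.toFun (r, F.toFun (min ε p.1, p.2)) ∈ E
  rw [F.map_add _ _ _ h2.1 h2.2]
  exact h1.2

/-- Reconstruct membership in the induced domain from short times and the shift. -/
theorem domInd_of_shift {Y : Type u} [TopologicalSpace Y] (F : PSemiflow Y) {E : Set Y} {ε : ℝ≥0}
    (hE : Set.Icc 0 ε ×ˢ E ⊆ F.dom) {p : ℝ≥0 × Y} (hpE : p.2 ∈ E)
    (h1 : ∀ r, F.toFun (min ε (min r p.1), p.2) ∈ E)
    (h2 : ε ≤ p.1 → (p.1 - ε, F.toFun (min ε p.1, p.2)) ∈ F.domInd E) :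
    p ∈ F.domInd E := by
  intro r hr
  have hr2 : r ≤ p.1 := hr.2
  rcases le_total r ε with h | h
  · refine ⟨hE ⟨⟨zero_le, h⟩, hpE⟩, ?_⟩
    have := h1 r
    rwa [min_eq_left hr2, min_eq_right h] at this
  · have h3 := h2 (h.trans hr2) (r - ε) ⟨zero_le, tsub_le_tsub_right hr2 ε⟩
    have h4 : (ε, p.2) ∈ F.dom := hE ⟨⟨zero_le, le_rfl⟩, hpE⟩
    have h5 : min ε p.1 = ε := min_eq_left (h.trans hr2)
    simp only [h5] at h3
    obtain ⟨h6, h7⟩ := h3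
    rw [F.map_add _ _ _ h4 h6, tsub_add_cancel_of_le h] at h7
    have h8 := (F.mem_add (r - ε) ε p.2).2 ⟨h4, h6⟩
    rw [tsub_add_cancel_of_le h] at h8
    exact ⟨h8, h7⟩

theorem isClosed_domInd {Y : Type u} [TopologicalSpace Y] (F : PSemiflow Y) {K : Set Y} {ε : ℝ≥0}
    (hε : 0 < ε) (hK : Set.Icc 0 ε ×ˢ K ⊆ F.dom) (hKc : IsClosed K) :
    IsClosed (F.domInd K) := by
  have hcl : ∀ p ∈ closure (F.domInd K), p.2 ∈ K := by
    intro p hp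
    exact closure_minimal (fun q hq => domInd_fst F hq) (hKc.preimage continuous_snd) hp
  have main : ∀ n : ℕ, ∀ p ∈ closure (F.domInd K), p.1 < (n + 1) * ε → p ∈ F.domInd K := by
    intro n
    induction n with
    | zero =>
      intro p hp hpn
      refine domInd_of_shift F hK (hcl p hp) ?_ ?_
      · intro r
        have hc : ContinuousOn (fun q : ℝ≥0 × Y => F.toFun (min ε (min r q.1), q.2))
            (closure (F.domInd K)) :=
          contOn_trunc F hK (by fun_prop) continuous_snd hcl
        refine hKc.closure_subset_iff.2 ?_ (hc.image_closure ⟨p, hp, rfl⟩)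
        rintro _ ⟨q, hq, rfl⟩
        exact (hq _ ⟨zero_le, (min_le_right _ _).trans (min_le_right _ _)⟩).2
      · intro h
        simp at hpn
        exact absurd h (not_le.2 hpn)
    | succ n ih =>
      intro p hp hpn
      refine domInd_of_shift F hK (hcl p hp) ?_ ?_
      · intro r
        have hc : ContinuousOn (fun q : ℝ≥0 × Y => F.toFun (min ε (min r q.1), q.2))
            (closure (F.domInd K)) :=
          contOn_trunc F hK (by fun_prop) continuous_snd hcl
        refine hKc.closure_subset_iff.2 ?_ (hc.image_closure ⟨p, hp, rfl⟩)
        rintro _ ⟨q, hq, rfl⟩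
        exact (hq _ ⟨zero_le, (min_le_right _ _).trans (min_le_right _ _)⟩).2
      · intro h
        apply ih
        · have hc : ContinuousOn
              (fun q : ℝ≥0 × Y => (q.1 - ε, F.toFun (min ε q.1, q.2)))
              (closure (F.domInd K)) :=
            (by fun_prop : Continuous fun q : ℝ≥0 × Y => q.1 - ε).continuousOn.prodMk
              (contOn_trunc F hK continuous_fst continuous_snd hcl)
          refine closure_mono ?_ (hc.image_closure ⟨p, hp, rfl⟩)
          rintro _ ⟨q, hq, rfl⟩
          exact domInd_shift F hq
        · show p.1 - ε < _
          rw [tsub_lt_iff_right h]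
          refine hpn.trans_le (le_of_eq ?_)
          push_cast
          ring
  rw [← closure_subset_iff_isClosed]
  intro p hp
  obtain ⟨n, hn⟩ := exists_nat_gt (p.1 / ε)
  refine main n p hp ?_
  rw [div_lt_iff₀ hε] at hn
  refine hn.trans_le ?_
  gcongr
  exact le_self_add

theorem isOpen_domInd {Y : Type u} [TopologicalSpace Y] (F : PSemiflow Y) {U : Set Y} {ε : ℝ≥0}
    (hε : 0 < ε) (hU : Set.Icc 0 ε ×ˢ U ⊆ F.dom) (hUo : IsOpen U) :
    IsOpen (F.domInd U) := by
  have hshort : ∀ p ∈ F.domInd U, ∀ᶠ q in nhds p,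
      q.2 ∈ U ∧ ∀ r, F.toFun (min ε (min r q.1), q.2) ∈ U := by
    intro p hp
    have e1 : ∀ᶠ q in nhds p, q.2 ∈ U :=
      continuous_snd.continuousAt.eventually (hUo.mem_nhds (domInd_fst F hp))
    have e2 : ∀ᶠ q in nhds p, ∀ r ∈ Set.Icc 0 ε, F.toFun (min ε (min r q.1), q.2) ∈ U := by
      apply (isCompact_Icc (a := (0 : ℝ≥0)) (b := ε)).eventually_forall_of_forall_eventually
      intro r hr
      have hc : ContinuousOn
          (fun z : (ℝ≥0 × Y) × ℝ≥0 => F.toFun (min ε (min z.2 z.1.1), z.1.2))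
          {z | z.1.2 ∈ U} :=
        contOn_trunc F hU (by fun_prop) (by fun_prop) (fun z hz => hz)
      have hop : IsOpen {z : (ℝ≥0 × Y) × ℝ≥0 | z.1.2 ∈ U} := hUo.preimage (by fun_prop)
      have hca := hc.continuousAt (hop.mem_nhds (show (p, r).1.2 ∈ U from domInd_fst F hp))
      exact hca.eventually (hUo.mem_nhds
        (hp _ ⟨zero_le, (min_le_right _ _).trans (min_le_right _ _)⟩).2)
    filter_upwards [e1, e2] with q h1 h2
    refine ⟨h1, fun r => ?_⟩
    have h3 := h2 (min ε r) ⟨zero_le, min_le_left _ _⟩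
    rwa [min_assoc, ← min_assoc, min_self] at h3
  have main : ∀ n : ℕ, ∀ p ∈ F.domInd U, p.1 < (n + 1) * ε → F.domInd U ∈ nhds p := by
    have hbase : ∀ p ∈ F.domInd U, p.1 < ε → F.domInd U ∈ nhds p := by
      intro p hp hlt
      filter_upwards [hshort p hp, continuous_fst.continuousAt.eventually (Iio_mem_nhds hlt)]
        with q hq hq2
      exact domInd_of_shift F hU hq.1 hq.2 (fun h => absurd h (not_le.2 hq2))
    intro n
    induction n with
    | zero =>
      intro p hp hpn
      exact hbase p hp (by simpa using hpn)
    | succ n ih =>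
      intro p hp hpn
      rcases lt_or_ge p.1 ε with h | h
      · exact hbase p hp h
      · have hc : ContinuousOn
            (fun q : ℝ≥0 × Y => (q.1 - ε, F.toFun (min ε q.1, q.2))) {q | q.2 ∈ U} :=
          (by fun_prop : Continuous fun q : ℝ≥0 × Y => q.1 - ε).continuousOn.prodMk
            (contOn_trunc F hU continuous_fst continuous_snd (fun z hz => hz))
        have hop : IsOpen {q : ℝ≥0 × Y | q.2 ∈ U} := hUo.preimage (by fun_prop)
        have hca := hc.continuousAt (hop.mem_nhds (domInd_fst F hp))
        have hD := ih _ (domInd_shift F (ε := ε) hp) (by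
          show p.1 - ε < _
          rw [tsub_lt_iff_right h]
          refine hpn.trans_le (le_of_eq ?_)
          push_cast
          ring)
        filter_upwards [hshort p hp, hca hD] with q hq hq2
        exact domInd_of_shift F hU hq.1 hq.2 (fun _ => hq2)
  rw [isOpen_iff_mem_nhds]
  intro p hp
  obtain ⟨n, hn⟩ := exists_nat_gt (p.1 / ε)
  refine main n p hp ?_
  rw [div_lt_iff₀ hε] at hn
  refine hn.trans_le ?_
  gcongr
  exact le_self_add

theorem stmt12 {Y : Type u} [TopologicalSpace Y]
    (hcg : CompactlyGeneratedSpaceP Y) (hwh : WeakHausdorffSpace Y)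
    (F : PSemiflow Y) :
    (∀ K : Set Y, IsCompact K → (∃ ε : ℝ≥0, 0 < ε ∧ Set.Icc 0 ε ×ˢ K ⊆ F.dom) →
      F.IndFiniteTimeProper K) ∧
    (∀ U : Set Y, IsOpen U → (∃ ε : ℝ≥0, 0 < ε ∧ Set.Icc 0 ε ×ˢ U ⊆ F.dom) →
      F.IndOpenlyDefined U) := by
  refine ⟨?_, ?_⟩
  · rintro K hK ⟨ε, hε, hdom⟩ t hmaps
    have hcl : ∀ A : Set Y, IsCompact A → IsClosed A :=
      fun A hA => isClosed_of_isCompact_cgwh hcg hwh hA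
    have hD := isClosed_domInd F hε hdom (hcl K hK)
    have hcomp : IsCompact (F.domInd K ∩ (Set.Icc 0 t ×ˢ (Set.univ : Set Y))) := by
      refine (isCompact_Icc (a := (0 : ℝ≥0)) (b := t)).prod hK |>.of_isClosed_subset
        (hD.inter (isClosed_Icc.prod isClosed_univ)) ?_
      rintro p ⟨hp, hp2, -⟩
      exact ⟨hp2, domInd_fst F hp⟩
    have hcs : CompactSpace ↥(F.domInd K ∩ (Set.Icc 0 t ×ˢ (Set.univ : Set Y))) :=
      isCompact_iff_compactSpace.1 hcomp
    have hcont : Continuous (Set.MapsTo.restrict F.toFun _ _ hmaps) := by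
      refine ContinuousOn.mapsToRestrict (F.cont.mono ?_) hmaps
      rintro p ⟨hp, -⟩
      exact (hp p.1 ⟨zero_le, le_rfl⟩).1
    rw [isProperMap_iff_isClosedMap_and_compact_fibers]
    refine ⟨hcont, ?_, ?_⟩
    · intro C hC
      have h1 : IsCompact (Subtype.val '' (Set.MapsTo.restrict F.toFun _ _ hmaps '' C)) :=
        (hC.isCompact.image hcont).image continuous_subtype_val
      have h2 := (hcl _ h1).preimage (continuous_subtype_val (p := (· ∈ K)))
      rwa [Set.preimage_image_eq _ Subtype.val_injective] at h2
    · intro y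
      have h1 : IsClosed ({y} : Set K) := by
        have h2 := (hcl {y.1} isCompact_singleton).preimage
          (continuous_subtype_val (p := (· ∈ K)))
        convert h2 using 1
        ext z
        simp [Subtype.ext_iff]
      exact (h1.preimage hcont).isCompact
  · rintro U hU ⟨ε, hε, hdom⟩
    exact (isOpen_domInd F hε hdom hU).preimage
      (by fun_prop : Continuous fun p : ℝ≥0 × ↥U => (p.1, (p.2 : Y)))

end PSemiflow
end

section
/- Let X be a locally compact Hausdorff space, F : ℝ≥0 × X ⇀ X a partial semiflow, and S an isolated F-invariant subset of X. Then: (1) S is compact; (2) for any two isolating neighbourhoods E and E' of S, one has E ∼_F E'. -/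
open Set Function
open scoped NNReal

namespace PSemiflow

variable {X : Type*} [TopologicalSpace X]

/-- Points whose orbit stays in `K` during `[0,b]`. -/
def stay (F : PSemiflow X) (K : Set X) (b : ℝ≥0) : Set X :=
  ⋂ t ∈ Set.Icc (0 : ℝ≥0) b, F.fpre t K

theorem mem_stay {F : PSemiflow X} {K : Set X} {b : ℝ≥0} {x : X} :
    x ∈ F.stay K b ↔ ∀ t ≤ b, (t, x) ∈ F.dom ∧ F.toFun (t, x) ∈ K := by
  simp [stay, fpre]

theorem stay_anti (F : PSemiflow X) (K : Set X) {b c : ℝ≥0} (h : b ≤ c) :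
    F.stay K c ⊆ F.stay K b := by
  intro x hx
  rw [mem_stay] at *
  exact fun t ht => hx t (ht.trans h)

theorem stay_step (F : PSemiflow X) (K : Set X) {b c : ℝ≥0} {x : X}
    (hx : x ∈ F.stay K (b + c)) : F.toFun (c, x) ∈ F.stay K b := by
  rw [mem_stay] at *
  intro t ht
  have h1 := hx (t + c) (by gcongr)
  have h2 := (F.mem_add t c x).1 h1.1
  exact ⟨h2.2, by rw [F.map_add t c x h2.1 h2.2]; exact h1.2⟩

theorem cont_time (F : PSemiflow X) (t : ℝ≥0) (A : Set X) (h : ∀ x ∈ A, (t, x) ∈ F.dom) :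
    ContinuousOn (fun x => F.toFun (t, x)) A :=
  F.cont.comp (by fun_prop) h

theorem stay_closed (F : PSemiflow X) (K : Set X) (hK : IsClosed K) (ε : ℝ≥0)
    (hd : Set.Icc 0 ε ×ˢ K ⊆ F.dom) (n : ℕ) :
    ∀ b ≤ n * ε, IsClosed (F.stay K b) := by
  induction n with
  | zero =>
    intro b hb
    have hb0 : b = 0 := by simpa using hb
    subst hb0
    have : F.stay K 0 = K := by
      ext x
      rw [mem_stay]
      constructor
      · intro h
        have := (h 0 le_rfl).2
        rwa [F.map_zero] at this
      · intro h t ht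
        have ht0 : t = 0 := by simpa using ht
        subst ht0
        rw [F.map_zero]
        exact ⟨F.mem_zero x, h⟩
    rwa [this]
  | succ n ih =>
    intro b hb
    rcases le_total b (n * ε) with h | h
    · exact ih b h
    have hc := ih _ le_rfl
    set c : ℝ≥0 := n * ε with hcdef
    have hbe : b ≤ ε + c := by
      rw [hcdef]; push_cast at hb; rw [add_mul, one_mul, add_comm] at hb; exact hb
    have hdom : ∀ t ≤ b, ∀ x ∈ F.stay K c, (t, x) ∈ F.dom := by
      intro t ht x hx
      rcases le_total t c with htc | htc
      · exact (mem_stay.1 hx t htc).1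
      · have hxc := mem_stay.1 hx c le_rfl
        have := (F.mem_add (t - c) c x).2 ⟨hxc.1, hd ⟨⟨zero_le, ?_⟩, hxc.2⟩⟩
        · rwa [tsub_add_cancel_of_le htc] at this
        · exact tsub_le_iff_right.2 (ht.trans hbe)
    have : F.stay K b = ⋂ t : {t : ℝ≥0 // t ≤ b},
        (F.stay K c ∩ (fun x => F.toFun (t.1, x)) ⁻¹' K) := by
      ext x
      simp only [mem_iInter, mem_inter_iff, mem_preimage, Subtype.forall]
      constructor
      · intro hx t ht
        exact ⟨F.stay_anti K h hx, (mem_stay.1 hx t ht).2⟩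
      · intro hx
        rw [mem_stay]
        intro t ht
        exact ⟨hdom t ht x (hx t ht).1, (hx t ht).2⟩
    rw [this]
    exact isClosed_iInter fun t =>
      (F.cont_time t.1 _ (hdom t.1 t.2)).preimage_isClosed_of_isClosed hc hK

/-- The image `f^n` of the points staying in `K` during `[0,2n]`. -/
def core (F : PSemiflow X) (K : Set X) (n : ℕ) : Set X :=
  (fun x => F.toFun ((n : ℝ≥0), x)) '' F.stay K (n + n)

theorem image_stay_subset (F : PSemiflow X) (K : Set X) {a b c e : ℝ≥0}
    (hab : a ≤ b) (h : b + c ≤ e) :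
    (fun x => F.toFun (a + c, x)) '' F.stay K e ⊆ (fun x => F.toFun (a, x)) '' F.stay K b := by
  rintro _ ⟨x, hx, rfl⟩
  have hx' := F.stay_anti K h hx
  have h1 := F.stay_step K hx'
  refine ⟨_, h1, ?_⟩
  exact F.map_add a c x (mem_stay.1 hx' c le_add_self).1 (mem_stay.1 h1 a hab).1

theorem invPart_eq (F : PSemiflow X) (K : Set X) : F.invPart K = ⋂ n, F.core K n := by
  apply Subset.antisymm
  · intro x hx
    simp only [invPart, mem_iInter] at hx
    exact mem_iInter.2 fun n => hx n (n + n) le_self_add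
  · intro x hx
    simp only [invPart, mem_iInter]
    intro a b hab
    obtain ⟨n, hn⟩ := exists_nat_ge b
    have h1 := mem_iInter.1 hx n
    have han : a ≤ n := hab.trans hn
    have h2 : a + ((n : ℝ≥0) - a) = n := add_tsub_cancel_of_le han
    have h3 := F.image_stay_subset K (c := (n : ℝ≥0) - a) (e := n + n) hab
      (add_le_add hn tsub_le_self)
    rw [h2] at h3
    exact h3 h1

theorem core_anti (F : PSemiflow X) (K : Set X) : Antitone (F.core K) := by
  apply antitone_nat_of_succ_le
  intro n
  have h := F.image_stay_subset K (a := n) (b := n + n) (c := 1)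
    (e := ((n + 1 : ℕ) : ℝ≥0) + ((n + 1 : ℕ) : ℝ≥0)) le_self_add
    (by
      push_cast
      calc (n : ℝ≥0) + n + 1 ≤ n + n + 1 + 1 := le_self_add
        _ = _ := by ring)
  simpa [core] using h

theorem core_compact (F : PSemiflow X) (K : Set X) (hK : IsCompact K) (hKc : IsClosed K)
    (ε : ℝ≥0) (hε : 0 < ε) (hd : Set.Icc 0 ε ×ˢ K ⊆ F.dom) (n : ℕ) :
    IsCompact (F.core K n) := by
  obtain ⟨m, hm⟩ := exists_nat_ge (((n : ℝ≥0) + n) / ε)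
  have hcl := F.stay_closed K hKc ε hd m (n + n) ((div_le_iff₀ hε).1 hm)
  have hsub : F.stay K (n + n) ⊆ K := by
    intro x hx
    have := (mem_stay.1 hx 0 zero_le).2
    rwa [F.map_zero] at this
  exact (hK.of_isClosed_subset hcl hsub).image_of_continuousOn
    (F.cont_time n _ fun x hx => (mem_stay.1 hx n le_self_add).1)

theorem half_sim [T2Space X] (F : PSemiflow X) {S E E' : Set X} (h : F.Isolating S E)
    (h' : S ⊆ interior E') :
    ∃ a b : ℝ≥0, a ≤ b ∧ (⋂ t ∈ Set.Icc (0 : ℝ≥0) b, F.fpre t E) ⊆ F.fpre a E' := by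
  obtain ⟨-, hK, ⟨ε, hε, hd⟩, hS⟩ := h
  have hc := F.core_compact _ hK isClosed_closure ε hε hd
  rw [hS, invPart_eq] at h'
  obtain ⟨n, hn⟩ := exists_subset_nhds_of_isCompact (F.core_anti _).directed_ge hc
    (U := interior E') fun x hx => isOpen_interior.mem_nhds (h' hx)
  refine ⟨n, n + n, le_self_add, ?_⟩
  intro x hx
  have hx1 : x ∈ F.stay E (n + n) := hx
  have hx2 : x ∈ F.stay (closure E) (n + n) := mem_stay.2 fun t ht =>
    ⟨(mem_stay.1 hx1 t ht).1, subset_closure (mem_stay.1 hx1 t ht).2⟩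
  exact ⟨(mem_stay.1 hx1 n le_self_add).1, interior_subset (hn ⟨x, hx2, rfl⟩)⟩

theorem stmt15 {Y : Type*} [TopologicalSpace Y] [LocallyCompactSpace Y] [T2Space Y]
    (F : PSemiflow Y) (S : Set Y) (hS : F.Invariant S)
    (hiso : ∃ E : Set Y, F.Isolating S E) :
    IsCompact S ∧
      ∀ E E' : Set Y, F.Isolating S E → F.Isolating S E' → F.Sim E E' := by
  constructor
  · obtain ⟨E, -, hK, ⟨ε, hε, hd⟩, hSE⟩ := hiso
    have hc := F.core_compact _ hK isClosed_closure ε hε hd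
    rw [hSE, invPart_eq]
    exact (hc 0).of_isClosed_subset (isClosed_iInter fun n => (hc n).isClosed)
      (iInter_subset _ 0)
  · intro E E' hE hE'
    obtain ⟨a, b, hab, h1⟩ := F.half_sim hE hE'.1
    obtain ⟨a', b', hab', h2⟩ := F.half_sim hE' hE.1
    exact ⟨a, b, a', b', hab, hab', h1, h2⟩

end PSemiflow
end

section
/- Let X be a locally compact Hausdorff space, F : ℝ≥0 × X ⇀ X a partial semiflow, and S an isolated F-invariant subset of X. Then the index neighbourhoods of S form a neighbourhood base for S: for every neighbourhood N of S there exists an index neighbourhood E of S with E ⊆ N. -/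
open Set Function
open scoped NNReal

namespace PSemiflow

variable {X : Type*} [TopologicalSpace X]

open Filter Topology

theorem domInd_mono (F : PSemiflow X) {E E' : Set X} (h : E ⊆ E') :
    F.domInd E ⊆ F.domInd E' :=
  fun _ hp s hs => ⟨(hp s hs).1, h (hp s hs).2⟩

theorem domInd_le (F : PSemiflow X) {E : Set X} {t s : ℝ≥0} {x : X}
    (h : (t, x) ∈ F.domInd E) (hs : s ≤ t) : (s, x) ∈ F.domInd E :=
  fun r hr => h r ⟨hr.1, hr.2.trans hs⟩

theorem domInd_dom (F : PSemiflow X) {E : Set X} {p : ℝ≥0 × X}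
    (h : p ∈ F.domInd E) : p ∈ F.dom := (h p.1 ⟨zero_le, le_rfl⟩).1

theorem domInd_map (F : PSemiflow X) {E : Set X} {p : ℝ≥0 × X}
    (h : p ∈ F.domInd E) : F.toFun p ∈ E := (h p.1 ⟨zero_le, le_rfl⟩).2

theorem domInd_base (F : PSemiflow X) {E : Set X} {t : ℝ≥0} {x : X}
    (h : (t, x) ∈ F.domInd E) : x ∈ E := by
  have := (h 0 ⟨le_rfl, zero_le⟩).2
  rwa [F.map_zero] at this

theorem domInd_zero (F : PSemiflow X) {E : Set X} {x : X}
    (h : x ∈ E) : (0, x) ∈ F.domInd E := by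
  intro s hs
  have : s = 0 := le_antisymm hs.2 hs.1
  subst this
  exact ⟨F.mem_zero x, by rw [F.map_zero]; exact h⟩

theorem domInd_add (F : PSemiflow X) {E : Set X} {t u : ℝ≥0} {x : X}
    (h : (u, x) ∈ F.domInd E) (h' : (t, F.toFun (u, x)) ∈ F.domInd E) :
    (t + u, x) ∈ F.domInd E := by
  intro s hs
  rcases le_total s u with hsu | hsu
  · exact h s ⟨zero_le, hsu⟩
  · have e : s = (s - u) + u := (tsub_add_cancel_of_le hsu).symm
    have h1 := h' (s - u) ⟨zero_le, tsub_le_iff_right.2 hs.2⟩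
    have h2 := F.domInd_dom h
    refine ⟨?_, ?_⟩
    · rw [e]; exact (F.mem_add _ _ _).2 ⟨h2, h1.1⟩
    · rw [e, ← F.map_add _ _ _ h2 h1.1]; exact h1.2

theorem domInd_shift_map (F : PSemiflow X) {E : Set X} {t u : ℝ≥0} {x : X}
    (h : (t + u, x) ∈ F.domInd E) : F.toFun (t, F.toFun (u, x)) = F.toFun (t + u, x) := by
  have := (F.mem_add t u x).1 (F.domInd_dom h)
  exact F.map_add _ _ _ this.1 this.2

theorem domInd_shift_s16 (F : PSemiflow X) {E : Set X} {t u : ℝ≥0} {x : X}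
    (h : (t + u, x) ∈ F.domInd E) : (t, F.toFun (u, x)) ∈ F.domInd E := by
  intro s hs
  have h1 : (s + u, x) ∈ F.domInd E := F.domInd_le h (by gcongr; exact hs.2)
  have := (F.mem_add s u x).1 (F.domInd_dom h1)
  exact ⟨this.2, by
    show F.toFun (s, F.toFun (u, x)) ∈ E
    rw [F.domInd_shift_map h1]; exact F.domInd_map h1⟩

/-- `{(t,x) ∈ domInd K, t ≤ c}` -/
def cdom (F : PSemiflow X) (K : Set X) (c : ℝ≥0) : Set (ℝ≥0 × X) :=
  F.domInd K ∩ {p | p.1 ≤ c}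

theorem cdom_base_closed (F : PSemiflow X) {K : Set X} (hK : IsClosed K) {ε : ℝ≥0}
    (hd : Set.Icc 0 ε ×ˢ K ⊆ F.dom) : IsClosed (F.cdom K ε) := by
  have hC : IsClosed ((Set.Icc 0 ε ×ˢ K) ∩ F.toFun ⁻¹' K) :=
    (F.cont.mono hd).preimage_isClosed_of_isClosed (isClosed_Icc.prod hK) hK
  have : F.cdom K ε = {p | p.1 ≤ ε} ∩ ⋂ θ ∈ Set.Icc (0 : ℝ≥0) 1,
      (fun p : ℝ≥0 × X => (θ * p.1, p.2)) ⁻¹' ((Set.Icc 0 ε ×ˢ K) ∩ F.toFun ⁻¹' K) := by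
    ext ⟨t, x⟩
    simp only [cdom, mem_inter_iff, mem_ofPred_eq, mem_iInter, mem_preimage]
    constructor
    · rintro ⟨h, ht⟩
      refine ⟨ht, fun θ hθ => ?_⟩
      have hle : θ * t ≤ t := mul_le_of_le_one_left zero_le hθ.2
      exact ⟨⟨⟨zero_le, hle.trans ht⟩, F.domInd_base h⟩, (h _ ⟨zero_le, hle⟩).2⟩
    · rintro ⟨ht, h⟩
      refine ⟨fun s hs => ?_, ht⟩
      obtain ⟨θ, hθ, e⟩ : ∃ θ ∈ Set.Icc (0 : ℝ≥0) 1, θ * t = s := by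
        rcases eq_or_ne t 0 with h0 | h0
        · exact ⟨0, ⟨le_rfl, zero_le⟩, by
            rw [zero_mul]; exact (le_antisymm (hs.2.trans h0.le) zero_le).symm⟩
        · exact ⟨s / t, ⟨zero_le, div_le_one_of_le₀ hs.2 zero_le⟩, div_mul_cancel₀ _ h0⟩
      have := h θ hθ
      rw [e] at this
      exact ⟨hd this.1, this.2⟩
  rw [this]
  refine (isClosed_le continuous_fst continuous_const).inter ?_
  refine isClosed_biInter fun θ _ => hC.preimage (by fun_prop)

theorem cdom_closed_nat (F : PSemiflow X) {K : Set X} (hK : IsClosed K) {ε : ℝ≥0}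
    (hd : Set.Icc 0 ε ×ˢ K ⊆ F.dom) (n : ℕ) : IsClosed (F.cdom K (n * ε)) := by
  induction n with
  | zero =>
    have h := (F.cdom_base_closed hK hd).inter
      (isClosed_le (continuous_fst (X := ℝ≥0) (Y := X)) (continuous_const (y := (0 : ℝ≥0))))
    convert h using 1
    ext ⟨t, x⟩
    simp only [cdom, mem_inter_iff, mem_ofPred_eq, Nat.cast_zero, zero_mul]
    constructor
    · rintro ⟨h1, h2⟩
      exact ⟨⟨h1, h2.trans zero_le⟩, h2⟩
    · rintro ⟨⟨h1, _⟩, h2⟩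
      exact ⟨h1, h2⟩
  | succ n ih =>
    have hA : IsClosed ((fun p : ℝ≥0 × X => (min p.1 ε, p.2)) ⁻¹' F.cdom K ε) :=
      (F.cdom_base_closed hK hd).preimage (by fun_prop)
    have hg : ContinuousOn (fun p : ℝ≥0 × X => (p.1 - ε, F.toFun (min p.1 ε, p.2)))
        ((fun p : ℝ≥0 × X => (min p.1 ε, p.2)) ⁻¹' F.cdom K ε) := by
      refine ContinuousOn.prodMk (by fun_prop) ?_
      refine F.cont.comp (f := fun p : ℝ≥0 × X => (min p.1 ε, p.2)) (by fun_prop) ?_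
      intro p hp
      exact F.domInd_dom hp.1
    convert hg.preimage_isClosed_of_isClosed hA ih using 1
    ext ⟨t, x⟩
    have e : (t - ε) + min t ε = t := tsub_add_min
    simp only [cdom, mem_inter_iff, mem_ofPred_eq, mem_preimage, Nat.cast_add, Nat.cast_one,
      add_mul, one_mul]
    constructor
    · rintro ⟨h1, h2⟩
      refine ⟨⟨F.domInd_le h1 (min_le_left _ _), min_le_right _ _⟩, ?_, tsub_le_iff_right.2 h2⟩
      exact F.domInd_shift_s16 (by rw [e]; exact h1)
    · rintro ⟨⟨h1, _⟩, h2, h3⟩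
      have := F.domInd_add h1 h2
      rw [e] at this
      exact ⟨this, tsub_le_iff_right.1 h3⟩

theorem cdom_closed (F : PSemiflow X) {K : Set X} (hK : IsClosed K) {ε : ℝ≥0} (hε : 0 < ε)
    (hd : Set.Icc 0 ε ×ˢ K ⊆ F.dom) (c : ℝ≥0) : IsClosed (F.cdom K c) := by
  obtain ⟨n, hn⟩ := exists_nat_ge (c / ε)
  have hc : c ≤ n * ε := (div_le_iff₀ hε).1 hn
  have h := (F.cdom_closed_nat hK hd n).inter
      (isClosed_le (continuous_fst (X := ℝ≥0) (Y := X)) (continuous_const (y := c)))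
  convert h using 1
  ext ⟨t, x⟩
  simp only [cdom, mem_inter_iff, mem_ofPred_eq]
  exact ⟨fun h => ⟨⟨h.1, h.2.trans hc⟩, h.2⟩, fun h => ⟨h.1.1, h.2⟩⟩

theorem cdom_compact [T2Space X] (F : PSemiflow X) {K : Set X} (hK : IsCompact K) {ε : ℝ≥0}
    (hε : 0 < ε) (hd : Set.Icc 0 ε ×ˢ K ⊆ F.dom) (c : ℝ≥0) : IsCompact (F.cdom K c) := by
  refine ((isCompact_Icc (a := (0 : ℝ≥0)) (b := c)).prod hK).of_isClosed_subset
    (F.cdom_closed hK.isClosed hε hd c) ?_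
  rintro ⟨t, x⟩ h
  exact ⟨⟨zero_le, h.2⟩, F.domInd_base h.1⟩

/-- `{x | (c,x) ∈ domInd K}` is compact. -/
theorem slice_compact [T2Space X] (F : PSemiflow X) {K : Set X} (hK : IsCompact K) {ε : ℝ≥0}
    (hε : 0 < ε) (hd : Set.Icc 0 ε ×ˢ K ⊆ F.dom) (c : ℝ≥0) :
    IsCompact {x | (c, x) ∈ F.domInd K} := by
  refine hK.of_isClosed_subset ?_ fun x hx => F.domInd_base hx
  have : {x | (c, x) ∈ F.domInd K} = (fun x => (c, x)) ⁻¹' F.cdom K c := by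
    ext x
    simp [cdom]
  rw [this]
  exact (F.cdom_closed hK.isClosed hε hd c).preimage (by fun_prop)

theorem open_base (F : PSemiflow X) {U : Set X} (hU : IsOpen U) {ε : ℝ≥0}
    (hd : Set.Icc 0 ε ×ˢ U ⊆ F.dom) {r : ℝ≥0} {y : X} (hr : r < ε)
    (h : (r, y) ∈ F.domInd U) : F.domInd U ∈ 𝓝 (r, y) := by
  have hd' : Set.Iio ε ×ˢ U ⊆ F.dom := fun p hp => hd ⟨⟨zero_le, le_of_lt hp.1⟩, hp.2⟩
  have hO : IsOpen ((Set.Iio ε ×ˢ U) ∩ F.toFun ⁻¹' U) :=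
    (F.cont.mono hd').isOpen_inter_preimage (isOpen_Iio.prod hU) hU
  have key : ∀ᶠ p : ℝ≥0 × X in 𝓝 (r, y), ∀ θ ∈ Set.Icc (0 : ℝ≥0) 1,
      (θ * p.1, p.2) ∈ ((Set.Iio ε ×ˢ U) ∩ F.toFun ⁻¹' U) := by
    refine isCompact_Icc.eventually_forall_of_forall_eventually fun θ hθ => ?_
    have hc : Continuous fun z : (ℝ≥0 × X) × ℝ≥0 => (z.2 * z.1.1, z.1.2) := by fun_prop
    refine hc.continuousAt.eventually (hO.mem_nhds ?_)
    have hle : θ * r ≤ r := mul_le_of_le_one_left zero_le hθ.2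
    exact ⟨⟨lt_of_le_of_lt hle hr, F.domInd_base h⟩, (h _ ⟨zero_le, hle⟩).2⟩
  filter_upwards [key]
  rintro ⟨t, x⟩ hp s hs
  obtain ⟨θ, hθ, e⟩ : ∃ θ ∈ Set.Icc (0 : ℝ≥0) 1, θ * t = s := by
    rcases eq_or_ne t 0 with h0 | h0
    · exact ⟨0, ⟨le_rfl, zero_le⟩, by
        rw [zero_mul]; exact (le_antisymm (hs.2.trans h0.le) zero_le).symm⟩
    · exact ⟨s / t, ⟨zero_le, div_le_one_of_le₀ hs.2 zero_le⟩, div_mul_cancel₀ _ h0⟩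
  have := hp θ hθ
  rw [e] at this
  exact ⟨hd' this.1, this.2⟩

theorem open_nat (F : PSemiflow X) {U : Set X} (hU : IsOpen U) {ε : ℝ≥0} (hε : 0 < ε)
    (hd : Set.Icc 0 ε ×ˢ U ⊆ F.dom) (n : ℕ) : ∀ {t : ℝ≥0} {x : X}, t ≤ n * (ε / 2) →
    (t, x) ∈ F.domInd U → F.domInd U ∈ 𝓝 (t, x) := by
  have hε2 : ε / 2 < ε := NNReal.half_lt_self hε.ne'
  induction n with
  | zero =>
    intro t x ht h
    refine F.open_base hU hd ?_ h
    exact lt_of_le_of_lt ht (by simpa using hε)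
  | succ n ih =>
    intro t x ht h
    set s := t - ε / 2 with hs
    have hsn : s ≤ n * (ε / 2) := tsub_le_iff_right.2 (by
      rwa [Nat.cast_add, Nat.cast_one, add_mul, one_mul] at ht)
    have hst : s ≤ t := tsub_le_self
    have hr : t - s < ε := lt_of_le_of_lt tsub_tsub_le hε2
    have e : (t - s) + s = t := tsub_add_cancel_of_le hst
    have h1 : (s, x) ∈ F.domInd U := F.domInd_le h hst
    have h2 := ih hsn h1
    have hdm : F.dom ∈ 𝓝 (s, x) := mem_of_superset h2 fun p hp => F.domInd_dom hp
    have hca : ContinuousAt F.toFun (s, x) := F.cont.continuousAt hdm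
    have h3 : (t - s, F.toFun (s, x)) ∈ F.domInd U := F.domInd_shift_s16 (by rw [e]; exact h)
    have h4 := F.open_base hU hd hr h3
    have c1 : ContinuousAt (fun p : ℝ≥0 × X => (s, p.2)) (t, x) := by fun_prop
    have c2 : ContinuousAt (fun p : ℝ≥0 × X => (p.1 - s, F.toFun (s, p.2))) (t, x) := by
      refine ContinuousAt.prodMk (by fun_prop) ?_
      exact ContinuousAt.comp (g := F.toFun) (f := fun p : ℝ≥0 × X => (s, p.2)) hca c1
    filter_upwards [c1.eventually h2, c2.eventually h4]
    rintro ⟨t', x'⟩ k1 k2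
    exact F.domInd_le (F.domInd_add k1 k2) le_tsub_add

theorem open_domInd (F : PSemiflow X) {U : Set X} (hU : IsOpen U) {ε : ℝ≥0} (hε : 0 < ε)
    (hd : Set.Icc 0 ε ×ˢ U ⊆ F.dom) : IsOpen (F.domInd U) := by
  rw [isOpen_iff_mem_nhds]
  rintro ⟨t, x⟩ h
  obtain ⟨n, hn⟩ := exists_nat_ge (t / (ε / 2))
  exact F.open_nat hU hε hd n ((div_le_iff₀ (half_pos hε)).1 hn) h

theorem slice_eq (F : PSemiflow X) (K : Set X) (b : ℝ≥0) :
    (⋂ t ∈ Set.Icc (0 : ℝ≥0) b, F.fpre t K) = {x | (b, x) ∈ F.domInd K} := by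
  ext x
  simp [domInd]

theorem mem_invPart (F : PSemiflow X) (K : Set X) (y : X) : y ∈ F.invPart K ↔
    ∀ a b : ℝ≥0, a ≤ b → ∃ x, (b, x) ∈ F.domInd K ∧ F.toFun (a, x) = y := by
  simp only [invPart, slice_eq, mem_iInter, mem_image, mem_ofPred_eq]

theorem invPart_mono (F : PSemiflow X) {K K' : Set X} (h : K ⊆ K') :
    F.invPart K ⊆ F.invPart K' := by
  intro y hy
  rw [mem_invPart] at *
  intro a b hab
  obtain ⟨x, h1, h2⟩ := hy a b hab
  exact ⟨x, F.domInd_mono h h1, h2⟩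

theorem Invariant.domInd {F : PSemiflow X} {S : Set X} (hS : F.Invariant S) (t : ℝ≥0) {x : X}
    (hx : x ∈ S) : (t, x) ∈ F.domInd S := fun s _ =>
  ⟨(hS s).1 x hx, by
    have := mem_image_of_mem (fun x => F.toFun (s, x)) hx
    rwa [(hS s).2] at this⟩

theorem Invariant.subset_invPart {F : PSemiflow X} {S K : Set X} (hS : F.Invariant S)
    (h : S ⊆ K) : S ⊆ F.invPart K := by
  intro y hy
  rw [mem_invPart]
  intro a b _
  have hy' := hy
  rw [← (hS a).2] at hy'
  obtain ⟨x, hx, e⟩ := hy'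
  exact ⟨x, F.domInd_mono h (hS.domInd b hx), e⟩

/-- The sets `f^c(K_{2c})`. -/
def gset (F : PSemiflow X) (K : Set X) (c : ℝ≥0) : Set X :=
  (fun x => F.toFun (c, x)) '' {x | (c + c, x) ∈ F.domInd K}

theorem gset_compact [T2Space X] (F : PSemiflow X) {K : Set X} (hK : IsCompact K) {ε : ℝ≥0}
    (hε : 0 < ε) (hd : Set.Icc 0 ε ×ˢ K ⊆ F.dom) (c : ℝ≥0) : IsCompact (F.gset K c) := by
  refine (F.slice_compact hK hε hd (c + c)).image_of_continuousOn ?_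
  refine F.cont.comp (f := fun x => (c, x)) (by fun_prop) ?_
  intro x hx
  exact F.domInd_dom (F.domInd_le hx (le_add_self))

theorem gset_aux (F : PSemiflow X) {K : Set X} {a b : ℝ≥0} (hab : a ≤ b) {y : X}
    (hy : y ∈ F.gset K b) : ∃ x, (a + b, x) ∈ F.domInd K ∧ F.toFun (a, x) = y := by
  obtain ⟨x, hx, e⟩ := hy
  have e1 : a + (b - a) = b := add_tsub_cancel_of_le hab
  have e2 : (a + b) + (b - a) = b + b := by rw [add_right_comm, e1]
  refine ⟨F.toFun (b - a, x), F.domInd_shift_s16 (by rw [e2]; exact hx), ?_⟩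
  have : (a + (b - a), x) ∈ F.domInd K := by
    rw [e1]; exact F.domInd_le hx le_add_self
  rw [F.domInd_shift_map this, e1]; exact e

theorem gset_anti (F : PSemiflow X) {K : Set X} : Antitone (F.gset K) := by
  intro a b hab y hy
  obtain ⟨x, hx, e⟩ := F.gset_aux hab hy
  exact ⟨x, F.domInd_le hx (by gcongr), e⟩

theorem iInter_gset (F : PSemiflow X) (K : Set X) : (⋂ c, F.gset K c) = F.invPart K := by
  ext y
  rw [mem_invPart, mem_iInter]
  constructor
  · intro h a b hab
    obtain ⟨x, hx, e⟩ := F.gset_aux hab (h b)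
    exact ⟨x, F.domInd_le hx le_add_self, e⟩
  · intro h c
    obtain ⟨x, hx, e⟩ := h c (c + c) le_add_self
    exact ⟨x, hx, e⟩

theorem invPart_compact [T2Space X] (F : PSemiflow X) {K : Set X} (hK : IsCompact K) {ε : ℝ≥0}
    (hε : 0 < ε) (hd : Set.Icc 0 ε ×ˢ K ⊆ F.dom) : IsCompact (F.invPart K) := by
  rw [← iInter_gset]
  exact (F.gset_compact hK hε hd 0).of_isClosed_subset
    (isClosed_iInter fun c => (F.gset_compact hK hε hd c).isClosed) (iInter_subset _ 0)

/-- The compact positively invariant set relative to `K`. -/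
def pset (F : PSemiflow X) (K V : Set X) (c : ℝ≥0) : Set X :=
  F.toFun '' (F.cdom K c ∩ {p | p.1 = c ∨ p.2 ∈ V})

theorem pset_compact [T2Space X] (F : PSemiflow X) {K V : Set X} (hK : IsCompact K) {ε : ℝ≥0}
    (hε : 0 < ε) (hd : Set.Icc 0 ε ×ˢ K ⊆ F.dom) (hV : IsClosed V) (c : ℝ≥0) :
    IsCompact (F.pset K V c) := by
  have hcl : IsClosed {p : ℝ≥0 × X | p.1 = c ∨ p.2 ∈ V} :=
    (isClosed_eq continuous_fst continuous_const).union (hV.preimage continuous_snd)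
  refine ((F.cdom_compact hK hε hd c).inter_right hcl).image_of_continuousOn ?_
  exact F.cont.mono fun p hp => F.domInd_dom hp.1.1

theorem pset_inv (F : PSemiflow X) {K V : Set X} {c s : ℝ≥0} {y : X}
    (hy : y ∈ F.pset K V c) (hs : (s, y) ∈ F.domInd K) : F.toFun (s, y) ∈ F.pset K V c := by
  obtain ⟨⟨t, x⟩, ⟨⟨h1, h2⟩, h3⟩, rfl⟩ := hy
  have h4 := F.domInd_add h1 hs
  rw [F.domInd_shift_map h4]
  rcases le_total (s + t) c with hc | hc
  · refine ⟨(s + t, x), ⟨⟨h4, hc⟩, ?_⟩, rfl⟩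
    rcases h3 with h3 | h3
    · exact Or.inl (le_antisymm hc ((le_of_eq h3.symm).trans le_add_self))
    · exact Or.inr h3
  · have e : c + (s + t - c) = s + t := add_tsub_cancel_of_le hc
    rw [← e] at h4
    refine ⟨(c, F.toFun (s + t - c, x)), ⟨⟨F.domInd_shift_s16 h4, le_refl c⟩, Or.inl rfl⟩, ?_⟩
    rw [F.domInd_shift_map h4, e]

theorem pset_int (F : PSemiflow X) {K V : Set X} {c : ℝ≥0} {y : X}
    (hV : ∀ x ∈ V, (c, x) ∈ F.domInd (interior K)) (hc : F.gset K c ⊆ interior K)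
    (hy : y ∈ F.pset K V c) (hs : (c, y) ∈ F.domInd K) : y ∈ interior K := by
  obtain ⟨⟨t, x⟩, ⟨⟨h1, h2⟩, h3⟩, rfl⟩ := hy
  rcases h3 with h3 | h3
  · have h3' : t = c := h3
    subst h3'
    exact hc ⟨x, F.domInd_add h1 hs, rfl⟩
  · exact F.domInd_map (F.domInd_le (hV x h3) h2)

/-- The index neighbourhood. -/
def eset (F : PSemiflow X) (K V : Set X) (c : ℝ≥0) : Set X :=
  F.pset K V c ∩ {x | (c, x) ∈ F.domInd (interior K)}

theorem domInd_eset (F : PSemiflow X) {K V : Set X} {c t : ℝ≥0} {x : X} :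
    (t, x) ∈ F.domInd (F.eset K V c) ↔
      x ∈ F.eset K V c ∧ (c + t, x) ∈ F.domInd (interior K) := by
  constructor
  · intro h
    refine ⟨F.domInd_base h, F.domInd_add ?_ (F.domInd_map h).2⟩
    refine F.domInd_mono ?_ h
    exact fun z hz => F.domInd_base hz.2
  · rintro ⟨h1, h2⟩ s hs
    have h3 : (c + s, x) ∈ F.domInd (interior K) := F.domInd_le h2 (by gcongr; exact hs.2)
    have h4 : (s, x) ∈ F.domInd (interior K) := F.domInd_le h3 le_add_self
    exact ⟨F.domInd_dom h4,
      F.pset_inv h1.1 (F.domInd_mono interior_subset h4), F.domInd_shift_s16 h3⟩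

theorem eset_proper [T2Space X] (F : PSemiflow X) {K V : Set X} (hK : IsCompact K) {ε : ℝ≥0}
    (hε : 0 < ε) (hd : Set.Icc 0 ε ×ˢ K ⊆ F.dom) {c : ℝ≥0} (hVc : IsClosed V)
    (hV : ∀ x ∈ V, (c, x) ∈ F.domInd (interior K)) (hc : F.gset K c ⊆ interior K) :
    F.IndFiniteTimeProper (F.eset K V c) := by
  intro t hmaps
  have hEK : F.eset K V c ⊆ K := fun z hz => interior_subset (F.domInd_base hz.2)
  rw [isProperMap_iff_ultrafilter]
  refine ⟨?_, ?_⟩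
  · refine ContinuousOn.mapsToRestrict ?_ hmaps
    exact F.cont.mono fun p hp => F.domInd_dom hp.1
  · rintro 𝒰 ⟨y, hy⟩ hlim
    have hlim' : Tendsto (fun p : ↥(F.domInd (F.eset K V c) ∩ Set.Icc 0 t ×ˢ Set.univ) =>
        F.toFun p.1) 𝒰 (𝓝 y) := (continuous_subtype_val.tendsto _).comp hlim
    have hmem : ∀ p : ↥(F.domInd (F.eset K V c) ∩ Set.Icc 0 t ×ˢ Set.univ),
        p.1 ∈ F.cdom K t := fun p => ⟨F.domInd_mono hEK p.2.1, p.2.2.1.2⟩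
    obtain ⟨⟨s, x⟩, hsx, hle⟩ := (F.cdom_compact hK hε hd t).ultrafilter_le_nhds
      (𝒰.map Subtype.val) (by
        rw [le_principal_iff]
        exact Filter.mem_map.2 (univ_mem' hmem))
    have hval : Tendsto (Subtype.val : ↥(F.domInd (F.eset K V c) ∩ Set.Icc 0 t ×ˢ Set.univ) → _)
        𝒰 (𝓝 (s, x)) := hle
    have hcont : ContinuousOn F.toFun (F.cdom K t) := F.cont.mono fun p hp => F.domInd_dom hp.1
    -- limits of truncated trajectories
    have hr : ∀ r ≤ s, Tendsto (fun p : ↥(F.domInd (F.eset K V c) ∩ Set.Icc 0 t ×ˢ Set.univ) =>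
        F.toFun (min r p.1.1, p.1.2)) 𝒰 (𝓝 (F.toFun (r, x))) := by
      intro r hrs
      have hm : (r, x) ∈ F.cdom K t := ⟨F.domInd_le hsx.1 hrs, hrs.trans hsx.2⟩
      refine (hcont _ hm).tendsto.comp (tendsto_nhdsWithin_iff.2 ⟨?_, ?_⟩)
      · have hc' : Continuous fun q : ℝ≥0 × X => (min r q.1, q.2) := by fun_prop
        have := (hc'.tendsto (s, x)).comp hval
        simpa [Function.comp_def, min_eq_left hrs] using this
      · refine Eventually.of_forall fun p => ?_
        exact ⟨F.domInd_le (hmem p).1 (min_le_right _ _),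
          show min r p.1.1 ≤ t from (min_le_right _ _).trans (hmem p).2⟩
    have hFy : F.toFun (s, x) = y := by
      refine tendsto_nhds_unique ?_ hlim'
      exact (hcont _ hsx).tendsto.comp
        (tendsto_nhdsWithin_iff.2 ⟨hval, Eventually.of_forall hmem⟩)
    have hP : ∀ r ≤ s, F.toFun (r, x) ∈ F.pset K V c := by
      intro r hrs
      refine (F.pset_compact hK hε hd hVc c).isClosed.mem_of_tendsto (hr r hrs)
        (Eventually.of_forall fun p => ?_)
      exact (p.2.1 (min r p.1.1) ⟨zero_le, min_le_right _ _⟩).2.1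
    have hcy : (c, F.toFun (s, x)) ∈ F.domInd (interior K) := by rw [hFy]; exact hy.2
    have hL : (c + s, x) ∈ F.domInd K :=
      F.domInd_add hsx.1 (F.domInd_mono interior_subset hcy)
    have hsW : (s, x) ∈ F.domInd (interior K) := by
      intro r hrs
      have h1 : (c + r, x) ∈ F.domInd K := F.domInd_le hL (by gcongr; exact hrs.2)
      refine ⟨F.domInd_dom (F.domInd_le hsx.1 hrs.2), ?_⟩
      exact F.pset_int hV hc (hP r hrs.2) (F.domInd_shift_s16 h1)
    have hW : (c + s, x) ∈ F.domInd (interior K) := F.domInd_add hsW hcy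
    have hx : x ∈ F.eset K V c := by
      refine ⟨?_, F.domInd_le hW le_self_add⟩
      have := hP 0 zero_le
      rwa [F.map_zero] at this
    refine ⟨⟨(s, x), F.domInd_eset.2 ⟨hx, hW⟩, ⟨zero_le, hsx.2⟩, mem_univ _⟩, ?_, ?_⟩
    · exact Subtype.ext hFy
    · exact tendsto_subtype_rng.2 hval

theorem stmt16 {Y : Type*} [TopologicalSpace Y] [LocallyCompactSpace Y] [T2Space Y]
    (F : PSemiflow Y) (S : Set Y) (hS : F.Invariant S)
    (hiso : ∃ E : Set Y, F.Isolating S E) :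
    ∀ N : Set Y, S ⊆ interior N →
      ∃ E : Set Y, E ⊆ N ∧ F.Isolating S E ∧ F.Cptif E := by
  intro N hN
  obtain ⟨E0, h0i, h0c, ⟨ε, hε, h0d⟩, h0S⟩ := hiso
  have hScpt : IsCompact S := by rw [h0S]; exact F.invPart_compact h0c hε h0d
  obtain ⟨K, hK, hSK, hKU⟩ := exists_compact_between hScpt
    (isOpen_interior.inter isOpen_interior) (subset_inter hN h0i)
  have hKN : K ⊆ N := fun x hx => interior_subset (hKU hx).1
  have hK0 : K ⊆ closure E0 := fun x hx => subset_closure (interior_subset (hKU hx).2)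
  have hd : Set.Icc 0 ε ×ˢ K ⊆ F.dom := fun p hp => h0d ⟨hp.1, hK0 hp.2⟩
  have hdi : Set.Icc 0 ε ×ˢ interior K ⊆ F.dom := fun p hp => hd ⟨hp.1, interior_subset hp.2⟩
  have hinv : F.invPart K ⊆ S := by
    conv_rhs => rw [h0S]
    exact F.invPart_mono hK0
  have hWo : IsOpen (F.domInd (interior K)) := F.open_domInd isOpen_interior hε hdi
  obtain ⟨c, hc⟩ : ∃ c, F.gset K c ⊆ interior K := by
    refine exists_subset_nhds_of_isCompact' (V := F.gset K) ?_
      (fun c => F.gset_compact hK hε hd c) (fun c => (F.gset_compact hK hε hd c).isClosed) ?_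
    · exact F.gset_anti.directed_ge
    · intro x hx
      rw [iInter_gset] at hx
      exact isOpen_interior.mem_nhds (hSK (hinv hx))
  have hUo : IsOpen {x | (c, x) ∈ F.domInd (interior K)} :=
    hWo.preimage (f := fun x => (c, x)) (by fun_prop)
  have hSU : S ⊆ {x | (c, x) ∈ F.domInd (interior K)} := fun x hx =>
    F.domInd_mono hSK (hS.domInd c hx)
  obtain ⟨V, hVc, hSV, hVU⟩ := exists_compact_between hScpt hUo hSU
  have hEK : F.eset K V c ⊆ K := fun z hz => interior_subset (F.domInd_base hz.2)
  have hclE : closure (F.eset K V c) ⊆ K := closure_minimal hEK hK.isClosed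
  have hSE : S ⊆ interior (F.eset K V c) := by
    intro x hx
    rw [mem_interior_iff_mem_nhds]
    refine mem_of_superset (inter_mem (isOpen_interior.mem_nhds (hSV hx))
      (hUo.mem_nhds (hSU hx))) ?_
    rintro z ⟨hz1, hz2⟩
    refine ⟨⟨(0, z), ⟨⟨F.domInd_zero (interior_subset (F.domInd_base hz2)),
      show (0 : ℝ≥0) ≤ c from zero_le⟩,
      Or.inr (interior_subset hz1)⟩, F.map_zero z⟩, hz2⟩
  refine ⟨F.eset K V c, hEK.trans hKN, ⟨hSE, hK.of_isClosed_subset isClosed_closure hclE,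
    ⟨ε, hε, fun p hp => hd ⟨hp.1, hclE hp.2⟩⟩, ?_⟩, ⟨?_, ?_⟩, ?_, inferInstance⟩
  · exact (hS.subset_invPart ((hSE.trans interior_subset).trans subset_closure)).antisymm
      ((F.invPart_mono hclE).trans hinv)
  · exact F.eset_proper hK hε hd hVc.isClosed hVU hc
  · have : {p : ℝ≥0 × ↥(F.eset K V c) | (p.1, (p.2 : Y)) ∈ F.domInd (F.eset K V c)} =
        (fun p : ℝ≥0 × ↥(F.eset K V c) => (c + p.1, (p.2 : Y))) ⁻¹' F.domInd (interior K) := by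
      ext ⟨t, x⟩
      simp only [mem_ofPred_eq, mem_preimage, domInd_eset]
      exact ⟨fun h => h.2, fun h => ⟨x.2, h⟩⟩
    unfold IndOpenlyDefined
    rw [this]
    exact hWo.preimage (by fun_prop)
  · have : IsLocallyClosed (F.eset K V c) :=
      (F.pset_compact hK hε hd hVc.isClosed c).isClosed.isLocallyClosed.inter
        hUo.isLocallyClosed
    exact this.locallyCompactSpace

end PSemiflow
end

section
/- Let F : ℝ≥0 × X ⇀ X be a partial semiflow on a topological space X, let E, E' ⊆ X, and let (a,b,c) ∈ A_F(E,E'). Assume the induced partial semiflow F_E : ℝ≥0 × E ⇀ E is finite-time proper and the induced partial semiflow F_{E'} : ℝ≥0 × E' ⇀ E' is openly defined. Put E'' = ⋂_{t∈[0,b]} f^{-t}(E) ∩ ⋂_{t'∈[a,c]} f^{-t'}(E'). Then: (1) E'' is weakly F-compactifiable (i.e. F_{E''} is finite-time proper and openly defined); (2) if moreover E and E' are locally compact Hausdorff in the subspace topology, then E'' is F-compactifiable (i.e. also locally compact Hausdorff). -/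
open Set Function
open scoped NNReal

namespace PSemiflow

variable {X : Type*} [TopologicalSpace X]

theorem mem_fpre_add (F : PSemiflow X) {E : Set X} {t u : ℝ≥0} {x : X} (hu : (u, x) ∈ F.dom) :
    F.toFun (u, x) ∈ F.fpre t E ↔ x ∈ F.fpre (t + u) E := by
  constructor
  · rintro ⟨h1, h2⟩
    refine ⟨(F.mem_add t u x).2 ⟨hu, h1⟩, ?_⟩
    rw [← F.map_add t u x hu h1]
    exact h2
  · rintro ⟨h1, h2⟩
    have h3 := ((F.mem_add t u x).1 h1).2
    refine ⟨h3, ?_⟩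
    rw [F.map_add t u x hu h3]
    exact h2

theorem mem_fpre_zero (F : PSemiflow X) {E : Set X} {x : X} : x ∈ F.fpre 0 E ↔ x ∈ E := by
  simp [fpre, F.mem_zero, F.map_zero]

theorem mem_dmain (F : PSemiflow X) {E E' : Set X} {a b c : ℝ≥0} {x : X} :
    x ∈ F.dmain E E' a b c ↔ (∀ s, s ≤ b → x ∈ F.fpre s E) ∧
      ∀ s, a ≤ s → s ≤ c → x ∈ F.fpre s E' := by
  simp [dmain]

theorem mem_domInd (F : PSemiflow X) {E : Set X} {t : ℝ≥0} {x : X} :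
    (t, x) ∈ F.domInd E ↔ ∀ s, s ≤ t → x ∈ F.fpre s E := by
  simp [domInd]

theorem mem_domInd_dmain (F : PSemiflow X) {E E' : Set X} {a b c t : ℝ≥0} {x : X}
    (hac : a ≤ c) :
    (t, x) ∈ F.domInd (F.dmain E E' a b c) ↔
      (∀ s, s ≤ t + b → x ∈ F.fpre s E) ∧
      ∀ s, a ≤ s → s ≤ t + c → x ∈ F.fpre s E' := by
  rw [mem_domInd]
  constructor
  · intro H
    constructor
    · intro s hs
      rcases le_total s t with hst | hst
      · have h1 := H s hst
        have h2 := (F.mem_dmain.1 h1.2).1 0 (by simp)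
        rw [F.mem_fpre_add h1.1, zero_add] at h2
        exact h2
      · have h1 := H t le_rfl
        have h2 := (F.mem_dmain.1 h1.2).1 (s - t) (by rw [tsub_le_iff_left]; exact hs)
        rw [F.mem_fpre_add h1.1, tsub_add_cancel_of_le hst] at h2
        exact h2
    · intro s has hs
      obtain ⟨d, rfl⟩ := exists_add_of_le has
      rcases le_total d t with hst | hst
      · have h1 := H d hst
        have h2 := (F.mem_dmain.1 h1.2).2 a le_rfl hac
        rw [F.mem_fpre_add h1.1] at h2
        exact h2
      · obtain ⟨e, rfl⟩ := exists_add_of_le hst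
        have h1 := H t le_rfl
        have h2 := (F.mem_dmain.1 h1.2).2 (a + e) (by simp)
          (by rw [add_left_comm] at hs; exact le_of_add_le_add_left hs)
        rw [F.mem_fpre_add h1.1, add_assoc, add_comm e t] at h2
        exact h2
  · rintro ⟨H1, H2⟩ r hr
    have hd : (r, x) ∈ F.dom := (H1 r (hr.trans (by simp))).1
    refine ⟨hd, F.mem_dmain.2 ⟨fun s hs => ?_, fun s h1 h2 => ?_⟩⟩
    · rw [F.mem_fpre_add hd]
      exact H1 _ (by rw [add_comm]; gcongr)
    · rw [F.mem_fpre_add hd]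
      exact H2 _ (h1.trans (by simp)) (by rw [add_comm]; gcongr)

/-- Points of `dmain`: the open condition. -/
theorem domInd_dmain_iff_open (F : PSemiflow X) {E E' : Set X} {a b c t : ℝ≥0} {x : X}
    (h : F.adm E E' a b c) (hx : ∀ s, s ≤ b → x ∈ F.fpre s E) :
    (t, x) ∈ F.domInd (F.dmain E E' a b c) ↔
      (t + (c - a), F.toFun (a, x)) ∈ F.domInd E' := by
  obtain ⟨hab, hbc, hA, hB⟩ := h
  have hac := hab.trans hbc
  have hda : (a, x) ∈ F.dom := (hx a hab).1
  rw [F.mem_domInd_dmain hac, mem_domInd]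
  constructor
  · rintro ⟨-, H2⟩ s hs
    rw [F.mem_fpre_add hda]
    refine H2 _ (by simp) ?_
    calc s + a ≤ t + (c - a) + a := by gcongr
      _ = t + c := by rw [add_assoc, tsub_add_cancel_of_le hac]
  · intro H
    have H2 : ∀ s, a ≤ s → s ≤ t + c → x ∈ F.fpre s E' := by
      intro s h1 h2
      have := H (s - a) (by
        rw [tsub_le_iff_right, add_assoc, tsub_add_cancel_of_le hac]; exact h2)
      rwa [F.mem_fpre_add hda, tsub_add_cancel_of_le h1] at this
    refine ⟨fun s hs => ?_, H2⟩
    rcases le_total s b with hsb | hsb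
    · exact hx s hsb
    · obtain ⟨r, rfl⟩ := exists_add_of_le hsb
      have hr : r ≤ t := by
        rw [add_comm] at hs; exact le_of_add_le_add_right hs
      have hdr : (a + r, x) ∈ F.dom := (H2 (a + r) (by simp) (by
        rw [add_comm]; gcongr)).1
      have := @hB (F.toFun (a + r, x)) (by
        simp only [mem_iInter]
        rintro u ⟨-, hu⟩
        rw [F.mem_fpre_add hdr]
        refine H2 _ (by rw [add_left_comm]; simp) ?_
        calc u + (a + r) ≤ (c - a) + (a + t) := by gcongr
          _ = t + c := by rw [← add_assoc, tsub_add_cancel_of_le hac, add_comm])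
      rw [F.mem_fpre_add hdr, ← add_assoc, tsub_add_cancel_of_le hab] at this
      exact this

/-- The domain of the induced semiflow on `dmain` is the preimage of `dmain`. -/
theorem domInd_dmain_iff_pre (F : PSemiflow X) {E E' : Set X} {a b c t : ℝ≥0} {x : X}
    (h : F.adm E E' a b c) :
    (t, x) ∈ F.domInd (F.dmain E E' a b c) ↔
      (t, x) ∈ F.domInd E ∧ F.toFun (t, x) ∈ F.dmain E E' a b c := by
  obtain ⟨hab, hbc, hA, hB⟩ := h
  have hac := hab.trans hbc
  constructor
  · intro H
    refine ⟨?_, (F.mem_domInd.1 H t le_rfl).2⟩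
    have := ((F.mem_domInd_dmain hac).1 H).1
    exact F.mem_domInd.2 fun s hs => this s (hs.trans (by simp))
  · rintro ⟨H1, H2⟩
    rw [F.mem_domInd] at H1
    rw [F.mem_dmain] at H2
    have hd := (H1 t le_rfl).1
    have K1 : ∀ s, s ≤ t + b → x ∈ F.fpre s E := by
      intro s hs
      rcases le_total s t with hst | hst
      · exact H1 s hst
      · have := H2.1 (s - t) (by rw [tsub_le_iff_left]; exact hs)
        rwa [F.mem_fpre_add hd, tsub_add_cancel_of_le hst] at this
    rw [F.mem_domInd_dmain hac]
    refine ⟨K1, fun s has hs => ?_⟩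
    obtain ⟨d, rfl⟩ := exists_add_of_le has
    rcases le_total d t with hst | hst
    · have hdd := (K1 d (hst.trans (by simp))).1
      have := @hA (F.toFun (d, x)) (by
        simp only [mem_iInter]
        rintro u ⟨-, hu⟩
        rw [F.mem_fpre_add hdd]
        exact K1 _ (by rw [add_comm]; gcongr))
      rwa [F.mem_fpre_add hdd] at this
    · obtain ⟨e, rfl⟩ := exists_add_of_le hst
      have h2 := H2.2 (a + e) (by simp)
          (by rw [add_left_comm] at hs; exact le_of_add_le_add_left hs)
      rw [F.mem_fpre_add hd, add_assoc, add_comm e t] at h2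
      exact h2

theorem mapsTo_domInd (F : PSemiflow X) (E : Set X) (t : ℝ≥0) :
    MapsTo F.toFun (F.domInd E ∩ (Set.Icc 0 t ×ˢ (Set.univ : Set X))) E := by
  rintro ⟨s, x⟩ ⟨h, -⟩
  exact (F.mem_domInd.1 h s le_rfl).2

theorem pproper_restrict {α β : Type*} [TopologicalSpace α] [TopologicalSpace β]
    {g : α → β} {S S' : Set α} {T T' : Set β} (hm : MapsTo g S T) (hp : PProper g S T)
    (hT : T' ⊆ T) (hS : ∀ x, x ∈ S' ↔ x ∈ S ∧ g x ∈ T') : PProper g S' T' := by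
  intro h'
  have hp := hp hm
  have hSS : S' ⊆ S := fun x hx => ((hS x).1 hx).1
  rw [isProperMap_iff_ultrafilter]
  constructor
  · rw [Topology.IsInducing.subtypeVal.continuous_iff]
    have hc : Continuous fun x : S' => (MapsTo.restrict g S T hm (Set.inclusion hSS x)).1 :=
      continuous_subtype_val.comp (hp.continuous.comp (continuous_inclusion hSS))
    exact hc
  · intro U y hy
    have hy2 : Filter.Tendsto (MapsTo.restrict g S T hm)
        ((U.map (Set.inclusion hSS) : Ultrafilter S) : Filter S)
        (nhds (Set.inclusion hT y)) := by
      rw [Ultrafilter.coe_map, Filter.tendsto_map'_iff]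
      exact (continuous_inclusion hT).continuousAt.tendsto.comp hy
    obtain ⟨x, hx, hxU⟩ := hp.ultrafilter_le_nhds_of_tendsto hy2
    have hgx : g x.1 = y.1 := congrArg Subtype.val hx
    refine ⟨⟨x.1, (hS _).2 ⟨x.2, hgx ▸ y.2⟩⟩, Subtype.ext hgx, ?_⟩
    rw [(Topology.IsEmbedding.inclusion hSS).isInducing.nhds_eq_comap]
    exact Filter.map_le_iff_le_comap.1 hxU

theorem stmt17 (F : PSemiflow X) (E E' : Set X) (a b c : ℝ≥0)
    (h : F.adm E E' a b c)
    (hp : F.IndFiniteTimeProper E) (ho : F.IndOpenlyDefined E') :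
    F.WCptif (F.dmain E E' a b c) ∧
      (LocallyCompactSpace E → T2Space E → LocallyCompactSpace E' → T2Space E' →
        F.Cptif (F.dmain E E' a b c)) := by
  have hab := h.1
  have hac := h.1.trans h.2.1
  have hsub : F.dmain E E' a b c ⊆ E := fun x hx =>
    F.mem_fpre_zero.1 ((F.mem_dmain.1 hx).1 0 (by simp))
  -- the set of points staying in `E` up to time `b`
  let Eb : Set X := {x | ∀ s, s ≤ b → x ∈ F.fpre s E}
  have hEb : F.dmain E E' a b c ⊆ Eb := fun x hx => (F.mem_dmain.1 hx).1
  have haE' : ∀ x ∈ Eb, F.toFun (a, x) ∈ E' := fun x hx =>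
    (h.2.2.1 (by simp only [mem_iInter]; rintro u ⟨-, hu⟩; exact hx u hu)).2
  have hca : Continuous fun x : Eb => F.toFun (a, x.1) :=
    F.cont.comp_continuous (by fun_prop) (fun x => (x.2 a hab).1)
  have hW : F.WCptif (F.dmain E E' a b c) := by
    constructor
    · intro t
      refine pproper_restrict (F.mapsTo_domInd E t) (hp t) hsub ?_
      rintro ⟨s, x⟩
      rw [mem_inter_iff, F.domInd_dmain_iff_pre h, mem_inter_iff]
      tauto
    · have hcont : Continuous fun p : ℝ≥0 × F.dmain E E' a b c =>
          ((p.1 + (c - a), ⟨F.toFun (a, p.2.1), haE' _ (hEb p.2.2)⟩) : ℝ≥0 × E') := by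
        refine Continuous.prodMk (by fun_prop) (Continuous.subtype_mk ?_ _)
        exact hca.comp ((continuous_inclusion hEb).comp continuous_snd)
      have := ho.preimage hcont
      unfold IndOpenlyDefined
      convert this using 1
      ext p
      exact F.domInd_dmain_iff_open h (hEb p.2.2)
  refine ⟨hW, fun hl ht _ _ => ⟨hW, ?_, ?_⟩⟩
  · have hEbE : Eb ⊆ E := fun x hx => F.mem_fpre_zero.1 (hx 0 (by simp))
    have : T2Space Eb := (Topology.IsEmbedding.inclusion hEbE).t2Space
    -- `f^b : Eb → E` is proper
    let S := F.domInd E ∩ (Set.Icc 0 b ×ˢ (Set.univ : Set X))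
    let i : Eb → S := fun x => ⟨(b, x.1), F.mem_domInd.2 x.2, by simp⟩
    have hi : Topology.IsClosedEmbedding i := by
      refine ⟨?_, ?_⟩
      · have hic : Continuous i := by fun_prop
        refine Topology.IsEmbedding.of_comp hic
          (continuous_snd.comp continuous_subtype_val) ?_
        exact Topology.IsEmbedding.subtypeVal
      · have : range i = {p : S | p.1.1 = b} := by
          ext ⟨⟨s, x⟩, hp1, hp2⟩
          constructor
          · rintro ⟨y, hy⟩
            exact (congrArg (fun p : S => p.1.1) hy).symm
          · intro hs
            have hs' : s = b := hs
            exact ⟨⟨x, fun r hr => F.mem_domInd.1 hp1 r (hr.trans hs'.ge)⟩,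
              Subtype.ext (Prod.ext hs'.symm rfl)⟩
        rw [this]
        exact isClosed_eq (by fun_prop) continuous_const
    have hpr := (hp b (F.mapsTo_domInd E b)).comp hi.isProperMap
    have : WeaklyLocallyCompactSpace Eb := by
      refine ⟨fun x => ?_⟩
      obtain ⟨K, hK, hKx⟩ := exists_compact_mem_nhds
        (((F.mapsTo_domInd E b).restrict _ _ _ ∘ i) x)
      exact ⟨_, hpr.isCompact_preimage hK, hpr.continuous.continuousAt hKx⟩
    refine Topology.IsOpenEmbedding.locallyCompactSpace (f := Set.inclusion hEb)
      ⟨Topology.IsEmbedding.inclusion hEb, ?_⟩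
    have hcont : Continuous fun x : Eb =>
        ((0 + (c - a), ⟨F.toFun (a, x.1), haE' _ x.2⟩) : ℝ≥0 × E') :=
      Continuous.prodMk continuous_const (Continuous.subtype_mk hca _)
    have := ho.preimage hcont
    convert this using 1
    ext x
    have key := F.domInd_dmain_iff_open (t := 0) h x.2
    rw [Set.range_inclusion]
    refine Iff.trans ?_ key
    rw [F.mem_domInd]
    constructor
    · intro hx s hs
      obtain rfl : s = 0 := le_antisymm hs (by simp)
      exact F.mem_fpre_zero.2 hx
    · intro hx
      exact F.mem_fpre_zero.1 (hx 0 le_rfl)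
  · exact (Topology.IsEmbedding.inclusion hsub).t2Space

end PSemiflow
end

section
/- Let X be a compactly generated weak Hausdorff space. Then: (1) every subset of X that is locally compact in the subspace topology is locally closed in X; (2) if X is locally compact, then every locally closed subset of X is locally compact in the subspace topology; (3) the intersection of two subsets of X that are locally compact in the subspace topology is locally compact in the subspace topology. -/
open Set

universe u

/-- `X` is weak Hausdorff: images of compact Hausdorff spaces under continuous maps
are closed. -/
def WeakHausdorffSpace (X : Type u) [TopologicalSpace X] : Prop :=
  ∀ (K : Type u) [TopologicalSpace K] [CompactSpace K] [T2Space K],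
    ∀ g : K → X, Continuous g → IsClosed (Set.range g)

/-- `X` is compactly generated: every compactly closed subset is closed. -/
def CompactlyGeneratedSpaceP (X : Type u) [TopologicalSpace X] : Prop :=
  ∀ A : Set X,
    (∀ (K : Type u) [TopologicalSpace K] [CompactSpace K] [T2Space K],
      ∀ g : K → X, Continuous g → IsClosed (g ⁻¹' A)) → IsClosed A

theorem kc_aux {X : Type u} [TopologicalSpace X]
    (hcg : CompactlyGeneratedSpaceP X) (hwh : WeakHausdorffSpace X) {C : Set X}
    (hC : IsCompact C) : IsClosed C := by
  have hpt : ∀ x : X, IsClosed ({x} : Set X) := fun x => by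
    have := hwh PUnit (fun _ => x) continuous_const
    simpa using this
  apply hcg
  intro K _ _ _ g hg
  have hcl : IsClosedMap g := by
    intro A hA
    haveI : CompactSpace A := isCompact_iff_compactSpace.mp hA.isCompact
    have := hwh A (fun a => g a) (hg.comp continuous_subtype_val)
    rwa [image_eq_range]
  have hp : IsProperMap g := isProperMap_iff_isClosedMap_and_compact_fibers.mpr
    ⟨hg, hcl, fun y => ((hpt y).preimage hg).isCompact⟩
  exact (hp.isCompact_preimage hC).isClosed

theorem lc_aux {X : Type u} [TopologicalSpace X]
    (hcg : CompactlyGeneratedSpaceP X) (hwh : WeakHausdorffSpace X) (E : Set X)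
    (hE : LocallyCompactSpace E) : IsLocallyClosed E := by
  refine ((isLocallyClosed_tfae E).out 0 3).mpr ?_
  intro x hx
  obtain ⟨C, hC, hCx⟩ := exists_compact_mem_nhds (⟨x, hx⟩ : E)
  obtain ⟨V, hV, hVC⟩ := (mem_nhds_subtype E ⟨x, hx⟩ C).mp hCx
  obtain ⟨U, hUV, hU, hxU⟩ := mem_nhds_iff.mp hV
  refine ⟨U, hxU, hU, ?_⟩
  have hcl : IsClosed (Subtype.val '' C) :=
    kc_aux hcg hwh (hC.image continuous_subtype_val)
  have hsub : U ∩ E ⊆ Subtype.val '' C := by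
    rintro y ⟨hyU, hyE⟩
    exact ⟨⟨y, hyE⟩, hVC (hUV hyU), rfl⟩
  intro y hy
  obtain ⟨z, -, rfl⟩ := closure_minimal hsub hcl (hU.inter_closure hy)
  exact z.2

theorem stmt19 {X : Type u} [TopologicalSpace X]
    (hcg : CompactlyGeneratedSpaceP X) (hwh : WeakHausdorffSpace X) :
    (∀ E : Set X, LocallyCompactSpace E → IsLocallyClosed E) ∧
      (LocallyCompactSpace X → ∀ E : Set X, IsLocallyClosed E → LocallyCompactSpace E) ∧
      (∀ E E' : Set X, LocallyCompactSpace E → LocallyCompactSpace E' →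
        LocallyCompactSpace ↥(E ∩ E')) := by
  refine ⟨lc_aux hcg hwh, fun _ E hE => hE.locallyCompactSpace, fun E E' hE hE' => ?_⟩
  have h1 : IsLocallyClosed (Subtype.val ⁻¹' E' : Set E) :=
    (lc_aux hcg hwh E' hE').preimage continuous_subtype_val
  have h2 : Topology.IsInducing (Set.inclusion (inter_subset_left : E ∩ E' ⊆ E)) :=
    (Topology.IsEmbedding.inclusion _).isInducing
  refine h2.locallyCompactSpace ?_
  convert h1
  ext x
  simp
end
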